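/- Nonvanishing of the mixed Wronskian: for real orders ν ≥ 0 and μ ≥ 0 with ν ≠ μ, the function W_{νμ}(x) = J_ν(x)·Y′_μ(x) − J′_ν(x)·Y_μ(x) is nonzero for every x ∈ (0, ∞) if and only if 0 < |ν − μ| ≤ 1. -/

import Mathlib

open Real Filter

/-- Bessel function of the first kind of real order `ν`:
`J_ν(x) = Σ_{k=0}^∞ ((−1)^k / (k! · Γ(ν+k+1))) · (x/2)^{ν+2k}`. -/
noncomputable def besselJ (ν : ℝ) (x : ℝ) : ℝ :=
  ∑' k : ℕ, ((-1 : ℝ) ^ k / ((k.factorial : ℝ) * Real.Gamma (ν + k + 1))) *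
    (x / 2) ^ (ν + 2 * (k : ℝ))

/-- Bessel function of the second kind of real order `ν`, defined as the limit
`Y_ν(x) = lim_{μ→ν, μ ∉ ℤ} (J_μ(x)·cos(μπ) − J_{−μ}(x)) / sin(μπ)`. -/
noncomputable def besselY (ν : ℝ) (x : ℝ) : ℝ :=
  limUnder (nhdsWithin ν {μ : ℝ | ∀ n : ℤ, μ ≠ (n : ℝ)})
    fun μ => (besselJ μ x * Real.cos (μ * π) - besselJ (-μ) x) / Real.sin (μ * π)

/-- `z s`, for integers `s ≥ 1`, enumerates all the positive real zeros of `f`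
in strictly increasing order. -/
structure IsPosZeroSeq (f : ℝ → ℝ) (z : ℕ → ℝ) : Prop where
  pos : ∀ s, 1 ≤ s → 0 < z s
  mono : ∀ s t, 1 ≤ s → s < t → z s < z t
  isZero : ∀ s, 1 ≤ s → f (z s) = 0
  complete : ∀ x, 0 < x → f x = 0 → ∃ s, 1 ≤ s ∧ z s = x

/-- `z s`, for integers `s ≥ 1`, enumerates the zeros `j'_{ν,s}` of `J'_ν`
(increasingly), with the convention that `x = 0` is counted as the first zero
`j'_{0,1}` of `J'_0`. -/
def IsBesselJDerivZeroSeq (ν : ℝ) (z : ℕ → ℝ) : Prop :=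
  (ν = 0 → z 1 = 0 ∧ IsPosZeroSeq (deriv (besselJ 0)) fun s => z (s + 1)) ∧
  (ν ≠ 0 → IsPosZeroSeq (deriv (besselJ ν)) z)

open MeasureTheory
open scoped Nat Topology

/-- The coefficients of `z ↦ Σ (-1)^k z^k / (k! Γ(s+k+1))`. -/
noncomputable def besselCoeff (s : ℂ) (k : ℕ) : ℂ :=
  (-1) ^ k / (k ! : ℂ) * (Complex.Gamma (s + k + 1))⁻¹

/-- The entire function `Σ (-1)^k z^k / (k! Γ(s+k+1))`, so that
`J_s(x) = (x/2)^s besselSeries s (x²/4)`. -/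
noncomputable def besselSeries (s z : ℂ) : ℂ := ∑' k : ℕ, besselCoeff s k * z ^ k

lemma exists_norm_inv_Gamma_le (R : ℝ) :
    ∃ C : ℝ, 0 ≤ C ∧ ∀ (k : ℕ) (s : ℂ), ‖s‖ ≤ R → ‖(Complex.Gamma (s + k + 1))⁻¹‖ ≤ C := by
  have hcpt : ∀ k : ℕ, ∃ C : ℝ, 0 ≤ C ∧
      ∀ s : ℂ, ‖s‖ ≤ R → ‖(Complex.Gamma (s + k + 1))⁻¹‖ ≤ C := by
    intro k
    have hc : Continuous fun s : ℂ => (Complex.Gamma (s + k + 1))⁻¹ :=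
      Complex.differentiable_one_div_Gamma.continuous.comp (by fun_prop)
    obtain ⟨C, hC⟩ := (isCompact_closedBall (0 : ℂ) R).exists_bound_of_continuousOn hc.continuousOn
    exact ⟨max C 0, le_max_right _ _,
      fun s hs => (hC s (by simpa using hs)).trans (le_max_left _ _)⟩
  choose C hC0 hC using hcpt
  set K := ⌈R⌉₊
  refine ⟨∑ k ∈ Finset.range (K + 1), C k, Finset.sum_nonneg fun k _ => hC0 k, ?_⟩
  have hle : ∀ k ≤ K, C k ≤ ∑ k ∈ Finset.range (K + 1), C k := fun k hk =>
    Finset.single_le_sum (fun k _ => hC0 k) (by simp; omega)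
  intro k s hs
  by_cases hk : k ≤ K
  · exact (hC k s hs).trans (hle k hk)
  · push Not at hk
    induction k, hk.le using Nat.le_induction with
    | base => exact (hC K s hs).trans (hle K le_rfl)
    | succ k hk' ih =>
      have h1 : ‖(Complex.Gamma (s + k + 1))⁻¹‖ ≤ ∑ k ∈ Finset.range (K + 1), C k := by
        rcases hk'.eq_or_lt with h | h
        · rw [← h]; exact (hC K s hs).trans (hle K le_rfl)
        · exact ih h
      refine le_trans ?_ h1
      rw [Complex.one_div_Gamma_eq_self_mul_one_div_Gamma_add_one (s + k + 1), norm_mul]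
      have h2 : 1 ≤ ‖s + k + 1‖ := by
        have h3 : ‖((k : ℂ) + 1)‖ ≤ ‖s + k + 1‖ + ‖s‖ := by
          have := norm_sub_le (s + k + 1) s
          simpa [add_assoc] using this
        have h4 : ‖((k : ℂ) + 1)‖ = k + 1 := by
          rw [← Nat.cast_add_one, Complex.norm_natCast]; simp
        have h5 : R ≤ k := (Nat.le_ceil R).trans (by exact_mod_cast hk')
        linarith
      have h6 : s + ((k + 1 : ℕ) : ℂ) + 1 = s + k + 1 + 1 := by push_cast; ring
      rw [h6]
      exact le_mul_of_one_le_left (norm_nonneg _) h2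

lemma exists_norm_besselCoeff_le (R : ℝ) :
    ∃ C : ℝ, 0 ≤ C ∧ ∀ (k : ℕ) (s : ℂ), ‖s‖ ≤ R → ‖besselCoeff s k‖ ≤ C / k ! := by
  obtain ⟨C, hC0, hC⟩ := exists_norm_inv_Gamma_le R
  refine ⟨C, hC0, fun k s hs => ?_⟩
  have := hC k s hs
  simp only [besselCoeff, norm_mul, norm_div, norm_pow, norm_neg, norm_one, one_pow,
    Complex.norm_natCast]
  rw [div_mul_eq_mul_div, one_mul]
  gcongr

lemma summable_besselCoeff_mul (s z : ℂ) : Summable fun k => besselCoeff s k * z ^ k := by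
  obtain ⟨C, -, hC⟩ := exists_norm_besselCoeff_le ‖s‖
  refine Summable.of_norm_bounded ((Real.summable_pow_div_factorial ‖z‖).mul_left C) fun k => ?_
  rw [norm_mul, norm_pow]
  calc _ ≤ C / k ! * ‖z‖ ^ k := by gcongr; exact hC k s le_rfl
    _ = _ := by ring

lemma exists_norm_besselSeries_le (R : ℝ) :
    ∃ C : ℝ, 0 ≤ C ∧ ∀ s z : ℂ, ‖s‖ ≤ R → ‖besselSeries s z‖ ≤ C * Real.exp ‖z‖ := by
  obtain ⟨C, hC0, hC⟩ := exists_norm_besselCoeff_le R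
  refine ⟨C, hC0, fun s z hs => ?_⟩
  refine tsum_of_norm_bounded (g := fun k : ℕ => C * (‖z‖ ^ k / k !)) ?_ fun k => ?_
  · rw [Real.exp_eq_exp_ℝ, NormedSpace.exp_eq_tsum_div]
    exact (Real.summable_pow_div_factorial ‖z‖).hasSum.mul_left C
  · rw [norm_mul, norm_pow]
    calc _ ≤ C / k ! * ‖z‖ ^ k := by gcongr; exact hC k s hs
      _ = _ := by ring

lemma differentiable_besselSeries_left (z : ℂ) : Differentiable ℂ fun s => besselSeries s z := by
  intro s
  obtain ⟨C, hC0, hC⟩ := exists_norm_besselCoeff_le (‖s‖ + 1)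
  have hd : DifferentiableOn ℂ (fun s => ∑' k : ℕ, besselCoeff s k * z ^ k)
      (Metric.ball 0 (‖s‖ + 1)) := by
    refine Complex.differentiableOn_tsum_of_summable_norm
      ((Real.summable_pow_div_factorial ‖z‖).mul_left C) (fun k => ?_) Metric.isOpen_ball
      fun k w hw => ?_
    · have : Differentiable ℂ fun s : ℂ => (Complex.Gamma (s + k + 1))⁻¹ :=
        Complex.differentiable_one_div_Gamma.comp (by fun_prop)
      exact ((this.const_mul _).mul_const _).differentiableOn
    · rw [norm_mul, norm_pow]
      calc _ ≤ C / k ! * ‖z‖ ^ k := by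
            gcongr; exact hC k w (by simpa using (Metric.mem_ball.1 hw).le)
        _ = _ := by ring
  exact hd.differentiableAt (Metric.isOpen_ball.mem_nhds (by simp))

lemma besselCoeff_succ (s : ℂ) (k : ℕ) :
    (k + 1) * besselCoeff s (k + 1) = -besselCoeff (s + 1) k := by
  unfold besselCoeff
  have h : (k ! : ℂ) ≠ 0 := by exact_mod_cast k.factorial_ne_zero
  have h' : (k : ℂ) + 1 ≠ 0 := by exact_mod_cast k.succ_ne_zero
  rw [Nat.factorial_succ, show s + ((k + 1 : ℕ) : ℂ) + 1 = s + 1 + k + 1 by push_cast; ring]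
  push_cast
  field_simp
  ring

lemma besselCoeff_sub_one (s : ℂ) (k : ℕ) :
    besselCoeff (s - 1) k = (s + k) * besselCoeff s k := by
  unfold besselCoeff
  have := Complex.one_div_Gamma_eq_self_mul_one_div_Gamma_add_one (s + k)
  rw [show s - 1 + k + 1 = s + k by ring, this]
  ring

lemma hasDerivAt_besselSeries (s z : ℂ) :
    HasDerivAt (besselSeries s) (-besselSeries (s + 1) z) z := by
  obtain ⟨C, hC0, hC⟩ := exists_norm_besselCoeff_le (max ‖s‖ ‖s + 1‖)
  set R := ‖z‖ + 1
  have key := hasDerivAt_tsum_of_isPreconnected (𝕜 := ℂ)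
    (u := fun k : ℕ => C * (k * R ^ (k - 1) / k !))
    (g := fun (k : ℕ) z => besselCoeff s k * z ^ k)
    (g' := fun (k : ℕ) z => besselCoeff s k * (k * z ^ (k - 1)))
    (t := Metric.ball 0 R) (y₀ := 0) (y := z) ?_ Metric.isOpen_ball
    (convex_ball _ _).isPreconnected
    (fun k w _ => (hasDerivAt_pow k w).const_mul _) (fun k w hw => ?_)
    (by simp [R]; positivity) (summable_besselCoeff_mul s 0) (by simp [R])
  · change HasDerivAt (fun z => ∑' k : ℕ, besselCoeff s k * z ^ k) _ z
    have hs : Summable fun k : ℕ => besselCoeff s k * (k * z ^ (k - 1)) := by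
      rw [← summable_nat_add_iff 1]
      refine (summable_besselCoeff_mul (s + 1) z).neg.congr fun k => ?_
      have := besselCoeff_succ s k
      push_cast
      rw [← mul_assoc, mul_comm (besselCoeff s (k + 1)), this, neg_mul]
    refine HasDerivAt.congr_deriv key ?_
    rw [hs.tsum_eq_zero_add, besselSeries, ← tsum_neg]
    simp only [Nat.cast_zero, zero_mul, mul_zero, zero_add]
    refine tsum_congr fun k => ?_
    have := besselCoeff_succ s k
    push_cast
    rw [← mul_assoc, mul_comm (besselCoeff s (k + 1)), this, neg_mul]
  · refine Summable.mul_left C ?_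
    rw [← summable_nat_add_iff 1]
    refine (Real.summable_pow_div_factorial R).congr fun k => ?_
    rw [Nat.factorial_succ]
    push_cast
    have h : (k ! : ℝ) ≠ 0 := by exact_mod_cast k.factorial_ne_zero
    have h' : (k : ℝ) + 1 ≠ 0 := by exact_mod_cast k.succ_ne_zero
    field_simp
  · have hw' : ‖w‖ ≤ R := by simpa using (Metric.mem_ball.1 hw).le
    rw [norm_mul, norm_mul, norm_pow, Complex.norm_natCast]
    calc _ ≤ C / k ! * (k * R ^ (k - 1)) := by
          gcongr; exact hC k s (le_max_left _ _)
      _ = _ := by ring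

lemma besselSeries_sub_one (s z : ℂ) :
    besselSeries (s - 1) z = s * besselSeries s z - z * besselSeries (s + 1) z := by
  have h1 := (summable_besselCoeff_mul s z).hasSum.mul_left s
  have h2 := (summable_besselCoeff_mul (s + 1) z).hasSum.mul_left (-z)
  have h3 : HasSum (fun k : ℕ => k * besselCoeff s k * z ^ k) (-z * besselSeries (s + 1) z) := by
    rw [← hasSum_nat_add_iff' 1]
    simp only [Finset.range_one, Finset.sum_singleton, Nat.cast_zero, zero_mul, sub_zero]
    refine h2.congr_fun fun k => ?_
    have := besselCoeff_succ s k
    push_cast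
    rw [this]; ring
  have h4 := h1.add h3
  rw [besselSeries, sub_eq_add_neg _ (z * _), ← neg_mul]
  refine (h4.congr_fun fun k => ?_).tsum_eq
  rw [besselCoeff_sub_one]; ring

lemma besselSeries_zero_right (s : ℂ) : besselSeries s 0 = (Complex.Gamma (s + 1))⁻¹ := by
  rw [besselSeries, tsum_eq_single 0 fun k hk => by simp [hk]]
  simp [besselCoeff]

/-- The Bessel function of the first kind with complex order and argument. -/
noncomputable def besselJC (s z : ℂ) : ℂ := (z / 2) ^ s * besselSeries s (z ^ 2 / 4)

/-- A family of functions on `(0, ∞)` satisfying the recurrences of the Bessel functions. -/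
structure IsCylinderFamily (u : ℝ → ℝ → ℝ) : Prop where
  hasDerivAt : ∀ ν x, 0 < x → HasDerivAt (u ν) ((u (ν - 1) x - u (ν + 1) x) / 2) x
  recurrence : ∀ ν x, 0 < x → x * (u (ν - 1) x + u (ν + 1) x) = 2 * ν * u ν x

lemma besselJC_recurrence (s : ℂ) {z : ℂ} (hz : z ≠ 0) :
    z * (besselJC (s - 1) z + besselJC (s + 1) z) = 2 * s * besselJC s z := by
  have h2 : z / 2 ≠ 0 := div_ne_zero hz two_ne_zero
  unfold besselJC
  rw [besselSeries_sub_one, Complex.cpow_sub _ _ h2, Complex.cpow_add _ _ h2, Complex.cpow_one]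
  field_simp
  ring

lemma hasDerivAt_besselJC (s : ℂ) {z : ℂ} (hz : z ∈ Complex.slitPlane) :
    HasDerivAt (besselJC s) ((besselJC (s - 1) z - besselJC (s + 1) z) / 2) z := by
  have hz0 : z ≠ 0 := Complex.slitPlane_ne_zero hz
  have h2 : z / 2 ≠ 0 := div_ne_zero hz0 two_ne_zero
  have hs : z / 2 ∈ Complex.slitPlane := by
    rw [Complex.mem_slitPlane_iff] at hz ⊢
    simpa using hz
  have h1 : HasDerivAt (fun z : ℂ => (z / 2) ^ s) (s * (z / 2) ^ (s - 1) * (1 / 2)) z :=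
    ((hasDerivAt_id z).div_const 2).cpow_const hs
  have h3 : HasDerivAt (fun z : ℂ => z ^ 2 / 4) (2 * z / 4) z := by
    simpa using (hasDerivAt_pow 2 z).div_const 4
  have h4 := h1.mul ((hasDerivAt_besselSeries s (z ^ 2 / 4)).comp z h3)
  refine h4.congr_deriv ?_
  unfold besselJC
  simp only [Function.comp]
  rw [besselSeries_sub_one, Complex.cpow_sub _ _ h2, Complex.cpow_add _ _ h2, Complex.cpow_one]
  field_simp
  ring

lemma differentiable_besselJC_left {z : ℂ} (hz : z ≠ 0) :
    Differentiable ℂ fun s => besselJC s z := by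
  have h2 : z / 2 ≠ 0 := div_ne_zero hz two_ne_zero
  exact (differentiable_id.const_cpow (Or.inl h2)).mul (differentiable_besselSeries_left _)

lemma besselJ_eq_rpow_mul_tsum (ν : ℝ) {x : ℝ} (hx : 0 < x) :
    besselJ ν x = (x / 2) ^ ν *
      ∑' k : ℕ, (-1 : ℝ) ^ k / k ! * (Real.Gamma (ν + k + 1))⁻¹ * (x ^ 2 / 4) ^ k := by
  rw [besselJ, ← tsum_mul_left]
  refine tsum_congr fun k => ?_
  have h2 : (0 : ℝ) < x / 2 := by positivity
  rw [Real.rpow_add h2, Real.rpow_mul h2.le, Real.rpow_natCast, Real.rpow_two,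
    show (x / 2) ^ 2 = x ^ 2 / 4 by ring, div_mul_eq_div_div, div_eq_mul_inv _ (Real.Gamma _)]
  ring

lemma ofReal_besselJ (ν : ℝ) {x : ℝ} (hx : 0 < x) : (besselJ ν x : ℂ) = besselJC ν x := by
  rw [besselJ_eq_rpow_mul_tsum ν hx, besselJC, besselSeries, Complex.ofReal_mul,
    Complex.ofReal_cpow (by positivity), Complex.ofReal_tsum]
  simp only [besselCoeff]
  push_cast
  congr 2 with k
  rw [← Complex.Gamma_ofReal]
  push_cast
  rfl

lemma isCylinderFamily_besselJ : IsCylinderFamily besselJ where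
  hasDerivAt ν x hx := by
    have h := (hasDerivAt_besselJC (ν : ℂ)
      (Complex.ofReal_mem_slitPlane.2 hx)).comp_ofReal
    have h1 := (Complex.reCLM.hasFDerivAt (x := besselJC ν x)).comp_hasDerivAt x h
    refine (h1.congr_deriv ?_).congr_of_eventuallyEq ?_
    · have e1 := ofReal_besselJ (ν - 1) hx
      have e2 := ofReal_besselJ (ν + 1) hx
      push_cast at e1 e2
      rw [← e1, ← e2]
      simp [← Complex.ofReal_sub]
    · filter_upwards [lt_mem_nhds hx] with y hy
      simp [← ofReal_besselJ ν hy]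
  recurrence ν x hx := by
    have h := besselJC_recurrence (ν : ℂ) (Complex.ofReal_ne_zero.2 hx.ne')
    have e1 := ofReal_besselJ (ν - 1) hx
    have e2 := ofReal_besselJ (ν + 1) hx
    push_cast at e1 e2
    rw [← e1, ← e2, ← ofReal_besselJ ν hx] at h
    exact_mod_cast h

lemma continuous_besselJ_left {x : ℝ} (hx : 0 < x) : Continuous fun ν => besselJ ν x := by
  have h : Continuous fun ν : ℝ => (besselJC ν x).re :=
    Complex.continuous_re.comp ((differentiable_besselJC_left
      (Complex.ofReal_ne_zero.2 hx.ne')).continuous.comp Complex.continuous_ofReal)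
  refine h.congr fun ν => ?_
  rw [← ofReal_besselJ ν hx, Complex.ofReal_re]

/-- `u` solves Bessel's equation of order `ν` on `(0, ∞)`. -/
structure IsBesselSolution (ν : ℝ) (u : ℝ → ℝ) : Prop where
  hasDerivAt : ∀ x, 0 < x → HasDerivAt u (deriv u x) x
  hasDerivAt_deriv : ∀ x, 0 < x →
    HasDerivAt (deriv u) (-(deriv u x / x) - (1 - ν ^ 2 / x ^ 2) * u x) x

namespace IsCylinderFamily

lemma deriv_eq_sub {u : ℝ → ℝ → ℝ} (hu : IsCylinderFamily u) (ν : ℝ) {x : ℝ} (hx : 0 < x) :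
    deriv (u ν) x = u (ν - 1) x - ν / x * u ν x := by
  rw [(hu.hasDerivAt ν x hx).deriv]
  have := hu.recurrence ν x hx
  field_simp
  linarith

lemma deriv_eq_sub' {u : ℝ → ℝ → ℝ} (hu : IsCylinderFamily u) (ν : ℝ) {x : ℝ} (hx : 0 < x) :
    deriv (u ν) x = ν / x * u ν x - u (ν + 1) x := by
  rw [(hu.hasDerivAt ν x hx).deriv]
  have := hu.recurrence ν x hx
  field_simp
  linarith

lemma isBesselSolution {u : ℝ → ℝ → ℝ} (hu : IsCylinderFamily u) (ν : ℝ) :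
    IsBesselSolution ν (u ν) where
  hasDerivAt x hx := (hu.hasDerivAt ν x hx).differentiableAt.hasDerivAt
  hasDerivAt_deriv x hx := by
    have h0 : HasDerivAt (u ν) (deriv (u ν) x) x :=
      (hu.hasDerivAt ν x hx).differentiableAt.hasDerivAt
    have h1 : HasDerivAt (u (ν + 1)) (deriv (u (ν + 1)) x) x :=
      (hu.hasDerivAt (ν + 1) x hx).differentiableAt.hasDerivAt
    have h2 : HasDerivAt (fun y : ℝ => ν / y) (-ν / x ^ 2) x := by
      simpa using (hasDerivAt_const x ν).fun_div (hasDerivAt_id x) hx.ne'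
    have h3 := (h2.mul h0).sub h1
    refine (h3.congr_deriv ?_).congr_of_eventuallyEq ?_
    · rw [hu.deriv_eq_sub (ν + 1) hx, add_sub_cancel_right]
      have := hu.deriv_eq_sub' ν hx
      rw [show u (ν + 1) x = ν / x * u ν x - deriv (u ν) x by linarith]
      field_simp
      ring
    · filter_upwards [lt_mem_nhds hx] with y hy
      exact hu.deriv_eq_sub' ν hy

end IsCylinderFamily

/-- The complex amplitude of a solution `u` of Bessel's equation: `√x u(x)` is the real part of
`besselAmp u x * exp (-i x)`, and `besselAmp u` converges at infinity. -/
noncomputable def besselAmp (u : ℝ → ℝ) (x : ℝ) : ℂ :=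
  (((√x * u x : ℝ) : ℂ) + ((√x * (deriv u x + u x / (2 * x)) : ℝ) : ℂ) * Complex.I) *
    Complex.exp (x * Complex.I)

lemma sqrt_mul_eq_re_besselAmp (u : ℝ → ℝ) (x : ℝ) :
    √x * u x = (besselAmp u x * Complex.exp (-(x * Complex.I))).re := by
  rw [besselAmp, mul_assoc, ← Complex.exp_add, add_neg_cancel, Complex.exp_zero, mul_one]
  simp only [Complex.add_re, Complex.ofReal_re, Complex.re_ofReal_mul, Complex.I_re, mul_zero,
    add_zero]

lemma im_besselAmp (u : ℝ → ℝ) (x : ℝ) :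
    √x * (deriv u x + u x / (2 * x)) = (besselAmp u x * Complex.exp (-(x * Complex.I))).im := by
  rw [besselAmp, mul_assoc, ← Complex.exp_add, add_neg_cancel, Complex.exp_zero, mul_one]
  simp only [Complex.add_im, Complex.ofReal_im, Complex.im_ofReal_mul, Complex.I_im, mul_one,
    zero_add]

lemma norm_besselAmp_sq (u : ℝ → ℝ) (x : ℝ) :
    ‖besselAmp u x‖ ^ 2 = (√x * u x) ^ 2 + (√x * (deriv u x + u x / (2 * x))) ^ 2 := by
  rw [besselAmp, norm_mul, Complex.norm_exp_ofReal_mul_I, mul_one, ← Complex.normSq_eq_norm_sq,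
    Complex.normSq_add_mul_I]

lemma mul_wronskian_eq_im_besselAmp (u v : ℝ → ℝ) {x : ℝ} (hx : 0 < x) :
    x * (u x * deriv v x - deriv u x * v x) =
      (starRingEnd ℂ (besselAmp u x) * besselAmp v x).im := by
  have h : starRingEnd ℂ (Complex.exp (x * Complex.I)) * Complex.exp (x * Complex.I) = 1 := by
    rw [← Complex.exp_conj, ← Complex.exp_add]; simp
  unfold besselAmp
  rw [map_mul, mul_mul_mul_comm, h, mul_one]
  simp only [map_add, map_mul, Complex.conj_ofReal, Complex.conj_I, Complex.mul_im,
    Complex.add_re, Complex.add_im, Complex.ofReal_re, Complex.ofReal_im, Complex.mul_re,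
    Complex.I_re, Complex.I_im, Complex.neg_re, Complex.neg_im]
  have hs : √x * √x = x := Real.mul_self_sqrt hx.le
  linear_combination (-(u x * deriv v x - deriv u x * v x)) * hs

namespace IsBesselSolution

lemma hasDerivAt_mul_wronskian {ν μ : ℝ} {u v : ℝ → ℝ} (hu : IsBesselSolution ν u)
    (hv : IsBesselSolution μ v) {x : ℝ} (hx : 0 < x) :
    HasDerivAt (fun x => x * (u x * deriv v x - deriv u x * v x))
      ((μ ^ 2 - ν ^ 2) / x * (u x * v x)) x := by
  have h := (hasDerivAt_id x).mul (((hu.hasDerivAt x hx).mul (hv.hasDerivAt_deriv x hx)).sub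
    ((hu.hasDerivAt_deriv x hx).mul (hv.hasDerivAt x hx)))
  refine h.congr_deriv ?_
  simp only [id, Pi.sub_apply, Pi.mul_apply]
  field_simp
  ring

lemma hasDerivAt_sqrt_mul {ν : ℝ} {u : ℝ → ℝ} (hu : IsBesselSolution ν u) {x : ℝ} (hx : 0 < x) :
    HasDerivAt (fun x => √x * u x) (√x * (deriv u x + u x / (2 * x))) x := by
  refine ((Real.hasDerivAt_sqrt hx.ne').mul (hu.hasDerivAt x hx)).congr_deriv ?_
  have hs : √x ^ 2 = x := Real.sq_sqrt hx.le
  have hs0 : √x ≠ 0 := (Real.sqrt_pos.2 hx).ne'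
  field_simp
  rw [hs]; ring

lemma hasDerivAt_sqrt_mul' {ν : ℝ} {u : ℝ → ℝ} (hu : IsBesselSolution ν u) {x : ℝ} (hx : 0 < x) :
    HasDerivAt (fun x => √x * (deriv u x + u x / (2 * x)))
      (((ν ^ 2 - 1 / 4) / x ^ 2 - 1) * (√x * u x)) x := by
  have h1 : HasDerivAt (fun x => u x / (2 * x))
      ((deriv u x * (2 * x) - u x * 2) / (2 * x) ^ 2) x := by
    have := (hu.hasDerivAt x hx).fun_div ((hasDerivAt_id x).const_mul 2) (by simpa using hx.ne')
    simpa using this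
  refine ((Real.hasDerivAt_sqrt hx.ne').mul ((hu.hasDerivAt_deriv x hx).add h1)).congr_deriv ?_
  have hs : √x ^ 2 = x := Real.sq_sqrt hx.le
  have hs0 : √x ≠ 0 := (Real.sqrt_pos.2 hx).ne'
  simp only [Pi.add_apply]
  field_simp
  rw [hs]; ring

lemma hasDerivAt_besselAmp {ν : ℝ} {u : ℝ → ℝ} (hu : IsBesselSolution ν u) {x : ℝ} (hx : 0 < x) :
    HasDerivAt (besselAmp u) (((ν ^ 2 - 1 / 4) / x ^ 2 * (√x * u x) : ℝ) * Complex.I *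
      Complex.exp (x * Complex.I)) x := by
  have h1 := (hu.hasDerivAt_sqrt_mul hx).ofReal_comp
  have h2 := (hu.hasDerivAt_sqrt_mul' hx).ofReal_comp
  have h3 : HasDerivAt (fun x : ℝ => Complex.exp (x * Complex.I))
      (Complex.exp (x * Complex.I) * (1 * Complex.I)) x :=
    ((Complex.ofRealCLM.hasDerivAt (x := x)).mul_const Complex.I).cexp
  refine ((h1.add (h2.mul_const Complex.I)).mul h3).congr_deriv ?_
  simp only [Pi.add_apply]
  push_cast
  linear_combination
    (√x : ℂ) * ((deriv u x : ℝ) + (u x : ℂ) / (2 * (x : ℂ))) * Complex.exp (x * Complex.I) *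
      Complex.I_sq

lemma norm_besselAmp_le {ν : ℝ} {u : ℝ → ℝ} (hu : IsBesselSolution ν u) {x : ℝ} (hx : 1 ≤ x) :
    ‖besselAmp u x‖ ≤ Real.exp |ν ^ 2 - 1 / 4| * ‖besselAmp u 1‖ := by
  set κ := ν ^ 2 - 1 / 4 with hκ
  have hd : ∀ y : ℝ, 0 < y → HasDerivAt
      (fun y => ‖besselAmp u y‖ ^ 2 * Real.exp (|κ| / y))
      ((2 * κ / y ^ 2 * (√y * u y) * (√y * (deriv u y + u y / (2 * y)))) * Real.exp (|κ| / y) +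
        ‖besselAmp u y‖ ^ 2 * (Real.exp (|κ| / y) * (-|κ| / y ^ 2))) y := by
    intro y hy
    have h1 := ((hu.hasDerivAt_sqrt_mul hy).pow 2).add ((hu.hasDerivAt_sqrt_mul' hy).pow 2)
    have h2 : HasDerivAt (fun y : ℝ => Real.exp (|κ| / y))
        (Real.exp (|κ| / y) * (-|κ| / y ^ 2)) y := by
      have : HasDerivAt (fun y : ℝ => |κ| / y) (-|κ| / y ^ 2) y := by
        simpa using (hasDerivAt_const y |κ|).fun_div (hasDerivAt_id y) hy.ne'
      exact this.exp
    have h3 : HasDerivAt (fun y => ‖besselAmp u y‖ ^ 2)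
        (2 * κ / y ^ 2 * (√y * u y) * (√y * (deriv u y + u y / (2 * y)))) y := by
      simp only [norm_besselAmp_sq]
      refine h1.congr_deriv ?_
      rw [← hκ]
      simp only [Nat.cast_ofNat, Nat.add_one_sub_one, pow_one]
      ring
    exact h3.mul h2
  have hanti : AntitoneOn (fun y => ‖besselAmp u y‖ ^ 2 * Real.exp (|κ| / y)) (Set.Ici 1) := by
    refine antitoneOn_of_deriv_nonpos (convex_Ici 1)
      (fun y hy => (hd y (zero_lt_one.trans_le hy)).continuousAt.continuousWithinAt)
      (fun y hy => ?_) (fun y hy => ?_)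
    · rw [interior_Ici] at hy
      exact (hd y (zero_lt_one.trans hy)).differentiableAt.differentiableWithinAt
    · rw [interior_Ici] at hy
      have hy0 : 0 < y := zero_lt_one.trans hy
      rw [(hd y hy0).deriv, norm_besselAmp_sq]
      set a := √y * u y
      set b := √y * (deriv u y + u y / (2 * y))
      have e : 2 * κ / y ^ 2 * a * b * Real.exp (|κ| / y) +
          (a ^ 2 + b ^ 2) * (Real.exp (|κ| / y) * (-|κ| / y ^ 2)) =
          Real.exp (|κ| / y) / y ^ 2 * (2 * κ * a * b - |κ| * (a ^ 2 + b ^ 2)) := by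
        field_simp
        ring
      rw [e]
      refine mul_nonpos_of_nonneg_of_nonpos (by positivity) ?_
      have h1 : 2 * κ * a * b ≤ |κ| * (2 * |a * b|) := by
        calc 2 * κ * a * b = 2 * (κ * (a * b)) := by ring
          _ ≤ 2 * |κ * (a * b)| := by gcongr; exact le_abs_self _
          _ = _ := by rw [abs_mul]; ring
      have h2 : 2 * |a * b| ≤ a ^ 2 + b ^ 2 := by
        rw [abs_mul]
        nlinarith [sq_nonneg (|a| - |b|), sq_abs a, sq_abs b]
      nlinarith [mul_le_mul_of_nonneg_left h2 (abs_nonneg κ)]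
  have h := hanti (Set.mem_Ici.2 le_rfl) (Set.mem_Ici.2 hx) hx
  simp only [div_one] at h
  have h1 : 1 ≤ Real.exp (|κ| / x) := Real.one_le_exp (by positivity)
  have h2 : 1 ≤ Real.exp |κ| := Real.one_le_exp (by positivity)
  refine abs_le_of_sq_le_sq' ?_ (by positivity) |>.2
  have h3 := sq_nonneg ‖besselAmp u x‖
  have h4 := sq_nonneg ‖besselAmp u 1‖
  calc ‖besselAmp u x‖ ^ 2 ≤ ‖besselAmp u x‖ ^ 2 * Real.exp (|κ| / x) := by nlinarith
    _ ≤ ‖besselAmp u 1‖ ^ 2 * Real.exp |κ| := h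
    _ ≤ ‖besselAmp u 1‖ ^ 2 * (Real.exp |κ| * Real.exp |κ|) := by gcongr; nlinarith
    _ = _ := by ring

lemma norm_besselAmp_sub_le {ν : ℝ} {u : ℝ → ℝ} (hu : IsBesselSolution ν u) {x y : ℝ}
    (hx : 1 ≤ x) (hxy : x ≤ y) :
    ‖besselAmp u y - besselAmp u x‖ ≤
      |ν ^ 2 - 1 / 4| * (Real.exp |ν ^ 2 - 1 / 4| * ‖besselAmp u 1‖) * (1 / x - 1 / y) := by
  set κ := ν ^ 2 - 1 / 4 with hκ
  set M := Real.exp |κ| * ‖besselAmp u 1‖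
  have hx0 : 0 < x := zero_lt_one.trans_le hx
  have hB : ∀ z : ℝ, 0 < z →
      HasDerivAt (fun z => |κ| * M * (1 / x - 1 / z)) (|κ| * M * (1 / z ^ 2)) z := by
    intro z hz
    have : HasDerivAt (fun z : ℝ => 1 / z) (-1 / z ^ 2) z := by
      simpa using (hasDerivAt_const z (1 : ℝ)).fun_div (hasDerivAt_id z) hz.ne'
    refine ((this.const_sub (1 / x)).const_mul (|κ| * M)).congr_deriv (by ring)
  have hA : ∀ z : ℝ, 0 < z → HasDerivAt (fun z => besselAmp u z - besselAmp u x) _ z :=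
    fun z hz => (hu.hasDerivAt_besselAmp hz).sub_const _
  refine image_norm_le_of_norm_deriv_right_le_deriv_boundary'
    (f := fun z => besselAmp u z - besselAmp u x) (a := x) (b := y)
    (B := fun z => |κ| * M * (1 / x - 1 / z)) (B' := fun z => |κ| * M * (1 / z ^ 2))
    (fun z hz => (hA z (hx0.trans_le hz.1)).continuousAt.continuousWithinAt)
    (fun z hz => (hA z (hx0.trans_le hz.1)).hasDerivWithinAt)
    (by simp) (fun z hz => (hB z (hx0.trans_le hz.1)).continuousAt.continuousWithinAt)
    (fun z hz => (hB z (hx0.trans_le hz.1)).hasDerivWithinAt)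
    (fun z hz => ?_) (Set.right_mem_Icc.2 hxy)
  have h1 := hu.norm_besselAmp_le (hx.trans hz.1)
  have h2 : |√z * u z| ≤ ‖besselAmp u z‖ := by
    refine abs_le_of_sq_le_sq ?_ (norm_nonneg _)
    rw [norm_besselAmp_sq]
    nlinarith [sq_nonneg (√z * (deriv u z + u z / (2 * z)))]
  rw [norm_mul, norm_mul, Complex.norm_exp_ofReal_mul_I, Complex.norm_I, mul_one, mul_one,
    Complex.norm_real, Real.norm_eq_abs, abs_mul, abs_div, abs_of_nonneg (sq_nonneg z)]
  calc |κ| / z ^ 2 * |√z * u z| ≤ |κ| / z ^ 2 * M := by gcongr; exact h2.trans h1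
    _ = _ := by ring

lemma exists_tendsto_besselAmp {ν : ℝ} {u : ℝ → ℝ} (hu : IsBesselSolution ν u) :
    ∃ c, Tendsto (besselAmp u) atTop (𝓝 c) := by
  refine cauchySeq_tendsto_of_complete (Metric.cauchySeq_iff'.2 fun ε hε => ?_)
  set K := |ν ^ 2 - 1 / 4| * (Real.exp |ν ^ 2 - 1 / 4| * ‖besselAmp u 1‖)
  have hK : 0 ≤ K := by positivity
  refine ⟨max 1 ((K + 1) / ε), fun y hy => ?_⟩
  set x := max 1 ((K + 1) / ε)
  have hx : 1 ≤ x := le_max_left _ _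
  have hx0 : 0 < x := zero_lt_one.trans_le hx
  have hy0 : 0 < y := hx0.trans_le hy
  rw [dist_eq_norm]
  calc _ ≤ K * (1 / x - 1 / y) := hu.norm_besselAmp_sub_le hx hy
    _ ≤ K * (1 / x) := by gcongr; have : 0 < 1 / y := by positivity
                          linarith
    _ < ε := by
      have : (K + 1) / ε ≤ x := le_max_right _ _
      rw [div_le_iff₀ hε] at this
      rw [mul_one_div, div_lt_iff₀ hx0]
      nlinarith

lemma norm_sub_besselAmp_le {ν : ℝ} {u : ℝ → ℝ} (hu : IsBesselSolution ν u) {c : ℂ}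
    (hc : Tendsto (besselAmp u) atTop (𝓝 c)) {x : ℝ} (hx : 1 ≤ x) :
    ‖c - besselAmp u x‖ ≤
      |ν ^ 2 - 1 / 4| * (Real.exp |ν ^ 2 - 1 / 4| * ‖besselAmp u 1‖) / x := by
  refine le_of_tendsto (hc.sub_const (besselAmp u x)).norm ?_
  filter_upwards [eventually_ge_atTop x] with y hy
  have hy0 : 0 < y := (zero_lt_one.trans_le hx).trans_le hy
  have : 0 < 1 / y := by positivity
  exact (hu.norm_besselAmp_sub_le hx hy).trans
    ((mul_le_mul_of_nonneg_left (by linarith : 1 / x - 1 / y ≤ 1 / x) (by positivity)).trans_eq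
      (mul_one_div _ _))

end IsBesselSolution

lemma tendsto_mul_wronskian {u v : ℝ → ℝ} {c d : ℂ} (hu : Tendsto (besselAmp u) atTop (𝓝 c))
    (hv : Tendsto (besselAmp v) atTop (𝓝 d)) :
    Tendsto (fun x => x * (u x * deriv v x - deriv u x * v x)) atTop
      (𝓝 (starRingEnd ℂ c * d).im) := by
  have h := (Complex.continuous_im.tendsto _).comp
    (((Complex.continuous_conj.tendsto c).comp hu).mul hv)
  refine h.congr' ?_
  filter_upwards [eventually_gt_atTop 0] with x hx
  exact (mul_wronskian_eq_im_besselAmp u v hx).symm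

lemma eq_zero_of_tendsto_re_mul_exp {c : ℂ}
    (h : Tendsto (fun x : ℝ => (c * Complex.exp (-(x * Complex.I))).re) atTop (𝓝 0)) : c = 0 := by
  have hseq : ∀ a : ℝ, (c * Complex.exp (-(a * Complex.I))).re = 0 := by
    intro a
    have ht : Tendsto (fun n : ℕ => a + n * (2 * π)) atTop atTop :=
      tendsto_atTop_add_const_left _ _ (tendsto_natCast_atTop_atTop.atTop_mul_const (by positivity))
    refine tendsto_nhds_unique (tendsto_const_nhds.congr fun n => ?_) (h.comp ht)
    have : Complex.exp (-(((a + n * (2 * π) : ℝ) : ℂ) * Complex.I)) =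
        Complex.exp (-(a * Complex.I)) := by
      rw [Complex.exp_eq_exp_iff_exists_int]
      exact ⟨-n, by push_cast; ring⟩
    simp only [Function.comp, this]
  have h0 := hseq 0
  have h1 := hseq (π / 2)
  have e : Complex.exp (-(((π / 2 : ℝ) : ℂ) * Complex.I)) = -Complex.I := by
    rw [Complex.exp_neg]
    push_cast
    rw [Complex.exp_pi_div_two_mul_I, Complex.inv_I]
  rw [e] at h1
  apply Complex.ext
  · simpa using h0
  · simpa using h1

lemma IsCylinderFamily.amp_add_one {u : ℝ → ℝ → ℝ} (hu : IsCylinderFamily u) {ν : ℝ} {c d : ℂ}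
    (hc : Tendsto (besselAmp (u ν)) atTop (𝓝 c))
    (hd : Tendsto (besselAmp (u (ν + 1))) atTop (𝓝 d)) : d = c * Complex.I := by
  have h0 : Tendsto (fun x => (besselAmp (u (ν + 1)) x - besselAmp (u ν) x * Complex.I -
      (d - c * Complex.I)) * Complex.exp (-(x * Complex.I))) atTop (𝓝 0) := by
    rw [tendsto_zero_iff_norm_tendsto_zero]
    have h := ((hd.sub (hc.mul_const Complex.I)).sub_const (d - c * Complex.I)).norm
    rw [sub_self, norm_zero] at h
    refine h.congr fun x => ?_
    rw [norm_mul, ← neg_mul, ← Complex.ofReal_neg, Complex.norm_exp_ofReal_mul_I, mul_one]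
  have h1 : Tendsto (fun x => (ν + 1 / 2) / x * (besselAmp (u ν) x *
      Complex.exp (-(x * Complex.I))).re) atTop (𝓝 0) := by
    have hb : Tendsto (fun x => |ν + 1 / 2| / x * ‖besselAmp (u ν) x‖) atTop (𝓝 (0 * ‖c‖)) :=
      (tendsto_const_nhds.div_atTop tendsto_id).mul hc.norm
    rw [zero_mul] at hb
    refine squeeze_zero_norm' ?_ hb
    filter_upwards [eventually_gt_atTop 0] with x hx
    rw [norm_mul, norm_div, Real.norm_eq_abs, Real.norm_eq_abs, Real.norm_eq_abs, abs_of_pos hx]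
    gcongr
    refine (Complex.abs_re_le_norm _).trans_eq ?_
    rw [norm_mul, ← neg_mul, ← Complex.ofReal_neg, Complex.norm_exp_ofReal_mul_I, mul_one]
  refine sub_eq_zero.1 (eq_zero_of_tendsto_re_mul_exp ?_)
  have h2 := h1.sub ((Complex.continuous_re.tendsto _).comp h0)
  rw [Complex.zero_re, sub_zero] at h2
  refine h2.congr' ?_
  filter_upwards [eventually_gt_atTop 0] with x hx
  have e1 := sqrt_mul_eq_re_besselAmp (u ν) x
  have e2 := im_besselAmp (u ν) x
  have e3 := sqrt_mul_eq_re_besselAmp (u (ν + 1)) x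
  have e4 := hu.deriv_eq_sub' ν hx
  set E := Complex.exp (-(x * Complex.I))
  have e5 : ((besselAmp (u (ν + 1)) x - besselAmp (u ν) x * Complex.I - (d - c * Complex.I)) *
      E).re = (besselAmp (u (ν + 1)) x * E).re + (besselAmp (u ν) x * E).im -
      ((d - c * Complex.I) * E).re := by
    rw [show (besselAmp (u (ν + 1)) x - besselAmp (u ν) x * Complex.I - (d - c * Complex.I)) * E =
      besselAmp (u (ν + 1)) x * E - besselAmp (u ν) x * E * Complex.I - (d - c * Complex.I) * E by
        ring, Complex.sub_re, Complex.sub_re, Complex.mul_I_re, sub_neg_eq_add]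
  simp only [Function.comp]
  rw [e5, ← e1, ← e2, ← e3, e4]
  field_simp
  ring

lemma besselJ_eq_rpow_mul (ν : ℝ) {x : ℝ} (hx : 0 < x) :
    besselJ ν x = x ^ ν * ((besselSeries ν ((x : ℂ) ^ 2 / 4)).re / 2 ^ ν) := by
  have h := congrArg Complex.re (ofReal_besselJ ν hx)
  rw [Complex.ofReal_re, besselJC, ← Complex.ofReal_ofNat, ← Complex.ofReal_div,
    ← Complex.ofReal_cpow (by positivity), Complex.re_ofReal_mul,
    Real.div_rpow hx.le two_pos.le] at h
  rw [h]
  ring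

lemma continuous_re_besselSeries (ν : ℝ) :
    Continuous fun x : ℝ => (besselSeries ν ((x : ℂ) ^ 2 / 4)).re := by
  have h : Continuous (besselSeries (ν : ℂ)) :=
    Differentiable.continuous (𝕜 := ℂ) fun z => (hasDerivAt_besselSeries ν z).differentiableAt
  exact Complex.continuous_re.comp (h.comp (by fun_prop))

lemma tendsto_besselJ_div_rpow (ν : ℝ) :
    Tendsto (fun x => besselJ ν x / x ^ ν) (𝓝[>] 0) (𝓝 ((Real.Gamma (ν + 1))⁻¹ / 2 ^ ν)) := by
  have h := ((continuous_re_besselSeries ν).tendsto 0).div_const ((2 : ℝ) ^ ν)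
  have e : (besselSeries ν (((0 : ℝ) : ℂ) ^ 2 / 4)).re = (Real.Gamma (ν + 1))⁻¹ := by
    rw [Complex.ofReal_zero, zero_pow two_ne_zero, zero_div, besselSeries_zero_right,
      ← Complex.ofReal_one, ← Complex.ofReal_add, Complex.Gamma_ofReal, ← Complex.ofReal_inv,
      Complex.ofReal_re]
  rw [e] at h
  refine (h.mono_left nhdsWithin_le_nhds).congr' ?_
  filter_upwards [self_mem_nhdsWithin] with x (hx : 0 < x)
  rw [besselJ_eq_rpow_mul ν hx, mul_div_cancel_left₀ _ (Real.rpow_pos_of_pos hx _).ne']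

lemma exists_abs_besselJ_le {ν : ℝ} (hν : 0 ≤ ν) :
    ∃ C, 0 ≤ C ∧ ∀ t, 0 < t → |besselJ ν t| ≤ C * t ^ ν ∧ √t * |besselJ ν t| ≤ C := by
  obtain ⟨C₁, h₁⟩ := isCompact_Icc.exists_bound_of_continuousOn (s := Set.Icc (0 : ℝ) 1)
    ((continuous_re_besselSeries ν).div_const ((2 : ℝ) ^ ν)).continuousOn
  obtain ⟨C₂, h₂, h₂'⟩ : ∃ C, 0 ≤ C ∧ ∀ t, 1 ≤ t → √t * |besselJ ν t| ≤ C := by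
    have hs := isCylinderFamily_besselJ.isBesselSolution ν
    refine ⟨Real.exp |ν ^ 2 - 1 / 4| * ‖besselAmp (besselJ ν) 1‖, by positivity, fun t ht => ?_⟩
    refine le_trans ?_ (hs.norm_besselAmp_le ht)
    rw [show √t * |besselJ ν t| = |√t * besselJ ν t| by
      rw [abs_mul, abs_of_nonneg (Real.sqrt_nonneg t)]]
    refine abs_le_of_sq_le_sq ?_ (norm_nonneg _)
    rw [norm_besselAmp_sq]
    exact le_add_of_nonneg_right (sq_nonneg _)
  have hC₁ : 0 ≤ C₁ := (norm_nonneg _).trans (h₁ 0 (by simp))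
  refine ⟨max C₁ C₂, le_max_of_le_left hC₁, fun t ht => ?_⟩
  have htν : 0 < t ^ ν := Real.rpow_pos_of_pos ht ν
  rcases le_total t 1 with h | h
  · have e : |besselJ ν t| ≤ C₁ * t ^ ν := by
      rw [besselJ_eq_rpow_mul ν ht, abs_mul, abs_of_pos htν, mul_comm]
      exact mul_le_mul_of_nonneg_right (h₁ t ⟨ht.le, h⟩) htν.le
    have h1 : t ^ ν ≤ 1 := Real.rpow_le_one ht.le h hν
    have h2 : √t ≤ 1 := Real.sqrt_le_one.2 h
    refine ⟨e.trans (by gcongr; exact le_max_left _ _), ?_⟩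
    calc √t * |besselJ ν t| ≤ 1 * (C₁ * 1) := by gcongr; exact e.trans (by gcongr)
      _ ≤ _ := by simp
  · have h1 : 1 ≤ t ^ ν := Real.one_le_rpow h hν
    have h2 : 1 ≤ √t := Real.one_le_sqrt.2 h
    have e := h₂' t h
    refine ⟨?_, e.trans (le_max_right _ _)⟩
    calc |besselJ ν t| ≤ √t * |besselJ ν t| := le_mul_of_one_le_left (abs_nonneg _) h2
      _ ≤ C₂ * 1 := by rwa [mul_one]
      _ ≤ _ := by gcongr; exact le_max_right _ _

lemma continuousOn_besselJ (ν : ℝ) : ContinuousOn (besselJ ν) (Set.Ioi 0) := fun x hx =>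
  (isCylinderFamily_besselJ.hasDerivAt ν x hx).continuousAt.continuousWithinAt

lemma integrableOn_rpow_mul_exp_neg_mul {s b : ℝ} (hs : -1 < s) (hb : 0 < b) :
    IntegrableOn (fun x : ℝ => x ^ s * Real.exp (-(b * x))) (Set.Ioi 0) := by
  simpa using integrableOn_rpow_mul_exp_neg_mul_rpow hs one_pos hb

/-- The Laplace transform of `t ^ α J_ν(t)`. -/
noncomputable def besselLaplace (α ν : ℝ) (p : ℂ) : ℂ :=
  ∫ t in Set.Ioi (0 : ℝ), ((t ^ α * besselJ ν t : ℝ) : ℂ) * Complex.exp (-(p * t))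

lemma aestronglyMeasurable_besselLaplace (α ν : ℝ) (p : ℂ) :
    AEStronglyMeasurable (fun t : ℝ => ((t ^ α * besselJ ν t : ℝ) : ℂ) * Complex.exp (-(p * t)))
      (volume.restrict (Set.Ioi 0)) := by
  refine ContinuousOn.aestronglyMeasurable ?_ measurableSet_Ioi
  refine ContinuousOn.mul (Complex.continuous_ofReal.comp_continuousOn
    (ContinuousOn.mul ?_ (continuousOn_besselJ ν))) (by fun_prop)
  exact fun x hx => (Real.continuousAt_rpow_const _ _ (Or.inl (ne_of_gt hx))).continuousWithinAt

lemma norm_besselLaplace_integrand_le {α ν C : ℝ} {t b : ℝ} (ht : 0 < t) {p : ℂ} (hp : b ≤ p.re)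
    (hC : |besselJ ν t| ≤ C * t ^ ν) :
    ‖((t ^ α * besselJ ν t : ℝ) : ℂ) * Complex.exp (-(p * t))‖ ≤
      C * (t ^ (α + ν) * Real.exp (-(b * t))) := by
  rw [norm_mul, Complex.norm_real, Complex.norm_exp, Real.norm_eq_abs, abs_mul,
    abs_of_pos (Real.rpow_pos_of_pos ht α), Real.rpow_add ht]
  have : (-(p * t)).re ≤ -(b * t) := by
    simp only [Complex.neg_re, Complex.mul_re, Complex.ofReal_re, Complex.ofReal_im, mul_zero,
      sub_zero]
    nlinarith
  have h1 : Real.exp (-(p * t)).re ≤ Real.exp (-(b * t)) := Real.exp_le_exp.2 this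
  have h2 : 0 < t ^ α := Real.rpow_pos_of_pos ht α
  calc t ^ α * |besselJ ν t| * Real.exp (-(p * t)).re
      ≤ t ^ α * (C * t ^ ν) * Real.exp (-(b * t)) :=
        mul_le_mul (mul_le_mul_of_nonneg_left hC h2.le) h1 (Real.exp_nonneg _)
          (mul_nonneg h2.le ((abs_nonneg _).trans hC))
    _ = _ := by ring

lemma integrable_besselLaplace {α ν : ℝ} (hν : 0 ≤ ν) (hα : -1 < α + ν) {p : ℂ} (hp : 0 < p.re) :
    IntegrableOn (fun t : ℝ => ((t ^ α * besselJ ν t : ℝ) : ℂ) * Complex.exp (-(p * t)))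
      (Set.Ioi 0) := by
  obtain ⟨C, hC, h⟩ := exists_abs_besselJ_le hν
  refine Integrable.mono' ((integrableOn_rpow_mul_exp_neg_mul hα hp).const_mul C)
    (aestronglyMeasurable_besselLaplace α ν p) ?_
  filter_upwards [ae_restrict_mem measurableSet_Ioi] with t ht
  exact norm_besselLaplace_integrand_le ht le_rfl (h t ht).1

lemma hasDerivAt_besselLaplace {α ν : ℝ} (hν : 0 ≤ ν) (hα : -1 < α + ν) {p : ℂ} (hp : 0 < p.re) :
    HasDerivAt (besselLaplace α ν) (-besselLaplace (α + 1) ν p) p := by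
  obtain ⟨C, hC, h⟩ := exists_abs_besselJ_le hν
  have hmem : {q : ℂ | p.re / 2 < q.re} ∈ 𝓝 p :=
    (isOpen_lt continuous_const Complex.continuous_re).mem_nhds (by simp; linarith)
  have key := (hasDerivAt_integral_of_dominated_loc_of_deriv_le
    (μ := volume.restrict (Set.Ioi (0 : ℝ)))
    (F := fun (p : ℂ) (t : ℝ) => ((t ^ α * besselJ ν t : ℝ) : ℂ) * Complex.exp (-(p * t)))
    (F' := fun (p : ℂ) (t : ℝ) =>
      -(((t ^ (α + 1) * besselJ ν t : ℝ) : ℂ) * Complex.exp (-(p * t))))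
    (bound := fun t => C * (t ^ (α + 1 + ν) * Real.exp (-(p.re / 2 * t)))) hmem
    (Eventually.of_forall fun q => aestronglyMeasurable_besselLaplace α ν q)
    (integrable_besselLaplace hν hα hp) (aestronglyMeasurable_besselLaplace (α + 1) ν p).neg
    ?_ ((integrableOn_rpow_mul_exp_neg_mul (by linarith) (by linarith)).const_mul C) ?_).2
  · rwa [integral_neg] at key
  · filter_upwards [ae_restrict_mem measurableSet_Ioi] with t ht q hq
    rw [norm_neg]
    exact norm_besselLaplace_integrand_le ht (le_of_lt hq) (h t ht).1
  · filter_upwards [ae_restrict_mem measurableSet_Ioi] with t ht q hq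
    have h1 : HasDerivAt (fun q : ℂ => Complex.exp (-(q * t)))
        (Complex.exp (-(q * t)) * (-(1 * t))) q :=
      (((hasDerivAt_id q).mul_const (t : ℂ)).neg).cexp
    refine (h1.const_mul _).congr_deriv ?_
    rw [Real.rpow_add ht, Real.rpow_one]
    push_cast
    ring

lemma besselLaplace_add_one {ν : ℝ} (hν : 0 ≤ ν) {p : ℂ} (hp : 0 < p.re) :
    (1 + p ^ 2) * besselLaplace (ν + 1) ν p = (2 * ν + 1) * p * besselLaplace ν ν p := by
  obtain ⟨C, hC, hJ⟩ := exists_abs_besselJ_le hν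
  obtain ⟨C', hC', hJ'⟩ := exists_abs_besselJ_le (show 0 ≤ ν + 1 by linarith)
  have i1 := integrable_besselLaplace (α := ν + 1) hν (by linarith) hp
  have i2 := integrable_besselLaplace (α := ν) hν (by linarith) hp
  set h : ℝ → ℂ := fun t => ((t ^ (ν + 1) * besselJ (ν + 1) t : ℝ) : ℂ) * Complex.exp (-(p * t)) -
    p * (((t ^ (ν + 1) * besselJ ν t : ℝ) : ℂ) * Complex.exp (-(p * t))) with hdef
  have hd : ∀ t ∈ Set.Ioi (0 : ℝ), HasDerivAt h
      ((1 + p ^ 2) * (((t ^ (ν + 1) * besselJ ν t : ℝ) : ℂ) * Complex.exp (-(p * t))) -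
        (2 * ν + 1) * p * (((t ^ ν * besselJ ν t : ℝ) : ℂ) * Complex.exp (-(p * t)))) t := by
    intro t (ht : 0 < t)
    have hJ := isCylinderFamily_besselJ
    have e1 : HasDerivAt (fun t : ℝ => t ^ (ν + 1)) ((ν + 1) * t ^ ν) t := by
      simpa using Real.hasDerivAt_rpow_const (x := t) (p := ν + 1) (Or.inl ht.ne')
    have d1 := (hJ.hasDerivAt (ν + 1) t ht).differentiableAt.hasDerivAt
    have d0 := (hJ.hasDerivAt ν t ht).differentiableAt.hasDerivAt
    rw [hJ.deriv_eq_sub _ ht, add_sub_cancel_right] at d1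
    rw [hJ.deriv_eq_sub' _ ht] at d0
    have e2 : HasDerivAt (fun t : ℝ => Complex.exp (-(p * t)))
        (Complex.exp (-(p * t)) * (-(p * 1))) t :=
      (((Complex.ofRealCLM.hasDerivAt (x := t)).const_mul p).neg).cexp
    have := ((e1.mul d1).ofReal_comp.mul e2).sub (((e1.mul d0).ofReal_comp.mul e2).const_mul p)
    refine this.congr_deriv ?_
    simp only [Pi.mul_apply]
    rw [Real.rpow_add ht, Real.rpow_one]
    have ht' : (t : ℂ) ≠ 0 := Complex.ofReal_ne_zero.2 ht.ne'
    push_cast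
    field_simp
    ring
  have hb : ∀ t : ℝ, 0 < t → ‖h t‖ ≤
      C' * (t ^ (2 * ν + 2) * Real.exp (-(p.re * t))) +
        ‖p‖ * (C * (t ^ (2 * ν + 1) * Real.exp (-(p.re * t)))) := by
    intro t ht
    have b1 := norm_besselLaplace_integrand_le (α := ν + 1) ht (le_refl p.re) (hJ' t ht).1
    have b2 := norm_besselLaplace_integrand_le (α := ν + 1) ht (le_refl p.re) (hJ t ht).1
    rw [show ν + 1 + (ν + 1) = 2 * ν + 2 by ring] at b1
    rw [show ν + 1 + ν = 2 * ν + 1 by ring] at b2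
    refine (norm_sub_le _ _).trans (add_le_add b1 ?_)
    rw [norm_mul]
    exact mul_le_mul_of_nonneg_left b2 (norm_nonneg _)
  have l0 : Tendsto h (𝓝[>] 0) (𝓝 0) := by
    have c : ∀ s : ℝ, 0 < s →
        Tendsto (fun t : ℝ => t ^ s * Real.exp (-(p.re * t))) (𝓝[>] 0) (𝓝 0) := by
      intro s hs
      have h1 := (Real.continuousAt_rpow_const 0 s (Or.inr hs.le)).tendsto
      have h2 : Tendsto (fun t : ℝ => Real.exp (-(p.re * t))) (𝓝 0) (𝓝 (Real.exp (-(p.re * 0)))) :=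
        Continuous.tendsto (by fun_prop) 0
      have := h1.mul h2
      rw [Real.zero_rpow hs.ne', zero_mul] at this
      exact this.mono_left nhdsWithin_le_nhds
    have := ((c (2 * ν + 2) (by linarith)).const_mul C').add
      (((c (2 * ν + 1) (by linarith)).const_mul C).const_mul ‖p‖)
    simp only [mul_zero, add_zero] at this
    refine squeeze_zero_norm' ?_ this
    filter_upwards [self_mem_nhdsWithin] with t ht using hb t ht
  have l1 : Tendsto h atTop (𝓝 0) := by
    have c : ∀ s : ℝ, Tendsto (fun t : ℝ => t ^ s * Real.exp (-(p.re * t))) atTop (𝓝 0) := by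
      intro s
      simpa using tendsto_rpow_mul_exp_neg_mul_atTop_nhds_zero s p.re hp
    have := ((c (2 * ν + 2)).const_mul C').add (((c (2 * ν + 1)).const_mul C).const_mul ‖p‖)
    simp only [mul_zero, add_zero] at this
    refine squeeze_zero_norm' ?_ this
    filter_upwards [eventually_gt_atTop 0] with t ht using hb t ht
  have key := integral_Ioi_of_hasDerivAt_of_tendsto (a := (0 : ℝ)) (f := Function.update h 0 0)
    (continuousWithinAt_update_same.2 (by rwa [Set.Ici_sdiff_left]))
    (fun t ht => (hd t ht).congr_of_eventuallyEq ?_)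
    ((i1.const_mul (1 + p ^ 2)).sub (i2.const_mul ((2 * ν + 1) * p)))
    (m := 0) (l1.congr' ?_)
  · rw [integral_sub (i1.const_mul _) (i2.const_mul _), integral_const_mul, integral_const_mul,
      Function.update_self, sub_zero] at key
    exact sub_eq_zero.1 key
  · filter_upwards [lt_mem_nhds ht] with y hy using Function.update_of_ne hy.ne' _ _
  · filter_upwards [eventually_gt_atTop 0] with y hy using (Function.update_of_ne hy.ne' _ _).symm

lemma one_add_sq_mem_slitPlane {p : ℂ} (hp : 0 < p.re) : 1 + p ^ 2 ∈ Complex.slitPlane := by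
  rw [Complex.mem_slitPlane_iff]
  by_contra! h
  have him : (1 + p ^ 2).im = 2 * p.re * p.im := by simp [sq]; ring
  have hre : (1 + p ^ 2).re = 1 + (p.re ^ 2 - p.im ^ 2) := by simp [sq]
  rw [him, hre] at h
  have h0 : p.im = 0 := by
    rcases mul_eq_zero.1 h.2 with h | h
    · linarith
    · exact h
  rw [h0] at h
  nlinarith [h.1, sq_nonneg p.re]

lemma hasDerivAt_besselLaplace_mul_cpow {ν : ℝ} (hν : 0 ≤ ν) {p : ℂ} (hp : 0 < p.re) :
    HasDerivAt (fun p : ℂ => besselLaplace ν ν p * (1 + p ^ 2) ^ ((ν : ℂ) + 1 / 2)) 0 p := by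
  have h1 := hasDerivAt_besselLaplace (α := ν) hν (by linarith) hp
  have h2 : HasDerivAt (fun p : ℂ => 1 + p ^ 2) (2 * p) p := by
    simpa using (hasDerivAt_pow 2 p).const_add 1
  have hs := one_add_sq_mem_slitPlane hp
  refine (h1.mul (h2.cpow_const (c := (ν : ℂ) + 1 / 2) hs)).congr_deriv ?_
  have hne := Complex.slitPlane_ne_zero hs
  rw [Complex.cpow_sub _ _ hne, Complex.cpow_one]
  have := besselLaplace_add_one hν hp
  generalize (1 + p ^ 2) ^ ((ν : ℂ) + 1 / 2) = P
  field_simp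
  linear_combination (-P) * this

lemma tendsto_besselLaplace_ofReal {ν : ℝ} (hν : 0 ≤ ν) :
    Tendsto (fun x : ℝ => besselLaplace ν ν x * (1 + (x : ℂ) ^ 2) ^ ((ν : ℂ) + 1 / 2)) atTop
      (𝓝 ((Real.Gamma (2 * ν + 1) * ((Real.Gamma (ν + 1))⁻¹ / 2 ^ ν) : ℝ) : ℂ)) := by
  obtain ⟨C, hC, hJ⟩ := exists_abs_besselJ_le hν
  set L := (Real.Gamma (ν + 1))⁻¹ / 2 ^ ν
  have hlim : Tendsto (fun x : ℝ => ∫ s in Set.Ioi (0 : ℝ),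
      s ^ (2 * ν) * Real.exp (-(1 * s)) * (besselJ ν (x⁻¹ * s) / (x⁻¹ * s) ^ ν)) atTop
      (𝓝 (∫ s in Set.Ioi (0 : ℝ), s ^ (2 * ν) * Real.exp (-(1 * s)) * L)) := by
    refine tendsto_integral_filter_of_dominated_convergence
      (fun s => s ^ (2 * ν) * Real.exp (-(1 * s)) * C) ?_ ?_
      ((integrableOn_rpow_mul_exp_neg_mul (by linarith) one_pos).mul_const C) ?_
    · filter_upwards [eventually_gt_atTop 0] with x hx
      refine ContinuousOn.aestronglyMeasurable ?_ measurableSet_Ioi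
      have hp : ∀ (f : ℝ → ℝ) (r : ℝ), ContinuousOn f (Set.Ioi 0) → (∀ s, 0 < s → 0 < f s) →
          ContinuousOn (fun s => f s ^ r) (Set.Ioi 0) := fun f r hf hf' s hs =>
        (hf s hs).rpow_const (Or.inl (hf' s hs).ne')
      refine ((hp _ _ continuousOn_id fun s hs => hs).mul (by fun_prop)).mul (ContinuousOn.div ?_
        (hp _ _ (by fun_prop) fun s hs => by positivity) ?_)
      · exact (continuousOn_besselJ ν).comp (by fun_prop)
          fun s (hs : 0 < s) => show 0 < x⁻¹ * s by positivity
      · intro s (hs : 0 < s)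
        have : 0 < x⁻¹ * s := by positivity
        exact (Real.rpow_pos_of_pos this ν).ne'
    · filter_upwards [eventually_gt_atTop 0] with x hx
      filter_upwards [ae_restrict_mem measurableSet_Ioi] with s (hs : 0 < s)
      have h0 : 0 < x⁻¹ * s := by positivity
      have h1 : 0 < (x⁻¹ * s) ^ ν := Real.rpow_pos_of_pos h0 ν
      have h2 : 0 ≤ s ^ (2 * ν) * Real.exp (-(1 * s)) := by positivity
      rw [Real.norm_eq_abs, abs_mul, abs_of_nonneg h2, abs_div, abs_of_pos h1]
      refine mul_le_mul_of_nonneg_left ?_ h2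
      rw [div_le_iff₀ h1]
      exact (hJ _ h0).1
    · filter_upwards [ae_restrict_mem measurableSet_Ioi] with s (hs : 0 < s)
      refine Tendsto.const_mul _ ((tendsto_besselJ_div_rpow ν).comp ?_)
      refine tendsto_nhdsWithin_iff.2 ⟨?_, ?_⟩
      · simpa using tendsto_inv_atTop_zero.mul_const s
      · filter_upwards [eventually_gt_atTop 0] with x hx
        exact show 0 < x⁻¹ * s by positivity
  have hint : ∫ s in Set.Ioi (0 : ℝ), s ^ (2 * ν) * Real.exp (-(1 * s)) * L =
      Real.Gamma (2 * ν + 1) * L := by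
    rw [integral_mul_const]
    have := Real.integral_rpow_mul_exp_neg_mul_Ioi (a := 2 * ν + 1) (by linarith) one_pos
    rw [add_sub_cancel_right] at this
    rw [this]
    simp
  rw [hint] at hlim
  have hpow : Tendsto (fun x : ℝ => (1 + (x ^ 2)⁻¹) ^ (ν + 1 / 2)) atTop (𝓝 1) := by
    have h1 : Tendsto (fun x : ℝ => 1 + (x ^ 2)⁻¹) atTop (𝓝 (1 + 0)) :=
      (tendsto_inv_atTop_zero.comp (tendsto_pow_atTop two_ne_zero)).const_add 1
    rw [add_zero] at h1
    simpa using h1.rpow_const (p := ν + 1 / 2) (Or.inl one_ne_zero)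
  have hmul := hlim.mul hpow
  rw [mul_one] at hmul
  refine ((Complex.continuous_ofReal.tendsto _).comp hmul).congr' ?_
  filter_upwards [eventually_gt_atTop 0] with x hx
  have hF : besselLaplace ν ν x =
      ((x⁻¹ * ∫ s in Set.Ioi (0 : ℝ), (x⁻¹ * s) ^ ν * besselJ ν (x⁻¹ * s) * Real.exp (-s) : ℝ) :
        ℂ) := by
    have hx' : 0 < x⁻¹ := by positivity
    have := integral_comp_mul_left_Ioi
      (fun t : ℝ => t ^ ν * besselJ ν t * Real.exp (-(x * t))) 0 hx'
    rw [mul_zero, inv_inv, smul_eq_mul] at this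
    have e : ∫ s in Set.Ioi (0 : ℝ), (x⁻¹ * s) ^ ν * besselJ ν (x⁻¹ * s) * Real.exp (-s) =
        x * ∫ t in Set.Ioi (0 : ℝ), t ^ ν * besselJ ν t * Real.exp (-(x * t)) := by
      rw [← this]
      congr 1 with s
      rw [mul_inv_cancel_left₀ hx.ne']
    rw [e, inv_mul_cancel_left₀ hx.ne', besselLaplace, ← integral_complex_ofReal]
    congr 1 with s
    push_cast
    rfl
  have h1 : (1 + (x : ℂ) ^ 2) ^ ((ν : ℂ) + 1 / 2) = (((1 + x ^ 2) ^ (ν + 1 / 2) : ℝ) : ℂ) := by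
    rw [Complex.ofReal_cpow (by positivity)]
    push_cast
    rfl
  rw [hF, h1, ← Complex.ofReal_mul]
  simp only [Function.comp]
  congr 1
  have h2 : (1 + x ^ 2) ^ (ν + 1 / 2) = x ^ (2 * ν) * x * (1 + (x ^ 2)⁻¹) ^ (ν + 1 / 2) := by
    rw [show 1 + x ^ 2 = x ^ 2 * (1 + (x ^ 2)⁻¹) by field_simp; ring,
      Real.mul_rpow (by positivity) (by positivity), ← Real.rpow_two, ← Real.rpow_mul hx.le,
      show 2 * (ν + 1 / 2) = 2 * ν + 1 by ring, Real.rpow_add hx, Real.rpow_one]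
  rw [h2]
  have h3 : ∫ s in Set.Ioi (0 : ℝ),
      s ^ (2 * ν) * Real.exp (-(1 * s)) * (besselJ ν (x⁻¹ * s) / (x⁻¹ * s) ^ ν) =
      x ^ (2 * ν) *
        ∫ s in Set.Ioi (0 : ℝ), (x⁻¹ * s) ^ ν * besselJ ν (x⁻¹ * s) * Real.exp (-s) := by
    rw [← integral_const_mul]
    refine setIntegral_congr_fun measurableSet_Ioi fun s (hs : 0 < s) => ?_
    have h0 : 0 < x⁻¹ * s := by positivity
    have hpos : 0 < (x⁻¹ * s) ^ ν := Real.rpow_pos_of_pos h0 ν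
    have e : s ^ (2 * ν) = x ^ (2 * ν) * ((x⁻¹ * s) ^ ν * (x⁻¹ * s) ^ ν) := by
      rw [← Real.rpow_add h0, ← two_mul, ← Real.mul_rpow hx.le h0.le, mul_inv_cancel_left₀ hx.ne']
    rw [e, one_mul]
    field_simp
  rw [h3]
  field_simp

lemma besselLaplace_mul_cpow {ν : ℝ} (hν : 0 ≤ ν) {p : ℂ} (hp : 0 < p.re) :
    besselLaplace ν ν p * (1 + p ^ 2) ^ ((ν : ℂ) + 1 / 2) =
      ((Real.Gamma (2 * ν + 1) * ((Real.Gamma (ν + 1))⁻¹ / 2 ^ ν) : ℝ) : ℂ) := by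
  refine (tendsto_nhds_unique (tendsto_besselLaplace_ofReal hν) (tendsto_const_nhds.congr' ?_)).symm
  filter_upwards [eventually_gt_atTop 0] with x hx
  have ho : IsOpen {q : ℂ | 0 < q.re} := isOpen_lt continuous_const Complex.continuous_re
  exact ho.is_const_of_deriv_eq_zero (convex_halfSpace_re_gt 0).isPreconnected
    (fun q hq =>
      (hasDerivAt_besselLaplace_mul_cpow hν hq).differentiableAt.differentiableWithinAt)
    (fun q hq => (hasDerivAt_besselLaplace_mul_cpow hν hq).deriv) hp (by simpa using hx)

lemma tendsto_integral_exp_mul_I (f : ℝ → ℂ) {b : ℝ} (hb : b ≠ 0) :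
    Tendsto (fun R : ℝ => ∫ s in Set.Ioi (0 : ℝ), f s * Complex.exp (b * (R * s) * Complex.I))
      atTop (𝓝 0) := by
  have h := Real.tendsto_integral_exp_smul_cocompact ((Set.Ioi (0 : ℝ)).indicator f)
  have ht : Tendsto (fun R : ℝ => R * -(b / (2 * π))) atTop (cocompact ℝ) := by
    have hc : -(b / (2 * π)) ≠ 0 := neg_ne_zero.2 (div_ne_zero hb (by positivity))
    exact (Filter.tendsto_cocompact_mul_right₀ hc).comp (atTop_le_cocompact)
  refine (h.comp ht).congr fun R => ?_
  simp only [Function.comp]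
  rw [← integral_indicator measurableSet_Ioi]
  congr 1 with s
  by_cases hs : s ∈ Set.Ioi (0 : ℝ)
  · rw [Set.indicator_of_mem hs, Set.indicator_of_mem hs, Circle.smul_def,
      Real.fourierChar_apply, smul_eq_mul, mul_comm]
    congr 2
    have : (π : ℂ) ≠ 0 := Complex.ofReal_ne_zero.2 pi_ne_zero
    push_cast
    field_simp
  · rw [Set.indicator_of_notMem hs, Set.indicator_of_notMem hs, smul_zero]

lemma tendsto_integral_sqrt_mul_besselJ {ν : ℝ} (hν : 0 ≤ ν) {c : ℂ}
    (hc : Tendsto (besselAmp (besselJ ν)) atTop (𝓝 c)) :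
    Tendsto (fun R : ℝ =>
      ∫ s in Set.Ioi (0 : ℝ), ((s ^ (ν - 1 / 2) * Real.exp (-(1 * s)) : ℝ) : ℂ) *
      ((√(R * s) * besselJ ν (R * s) : ℝ) * Complex.exp ((R * s : ℝ) * Complex.I))) atTop
      (𝓝 (c / 2 * Real.Gamma (ν + 1 / 2))) := by
  obtain ⟨C, hC, hJ⟩ := exists_abs_besselJ_le hν
  set w : ℝ → ℂ := fun s => ((s ^ (ν - 1 / 2) * Real.exp (-(1 * s)) : ℝ) : ℂ) with hw
  have hwr := integrableOn_rpow_mul_exp_neg_mul (s := ν - 1 / 2) (by linarith) one_pos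
  have hwi : IntegrableOn w (Set.Ioi 0) := hwr.ofReal
  have hwint : ∫ s in Set.Ioi (0 : ℝ), w s = Real.Gamma (ν + 1 / 2) := by
    have := Real.integral_rpow_mul_exp_neg_mul_Ioi (a := ν + 1 / 2) (by linarith) one_pos
    rw [show ν + 1 / 2 - 1 = ν - 1 / 2 by ring] at this
    rw [hw, integral_complex_ofReal, this]
    simp
  set g : ℝ → ℂ := fun t => ((√t * besselJ ν t : ℝ) : ℂ) * Complex.exp (t * Complex.I) with hg
  set e : ℝ → ℂ := fun t => Complex.exp ((2 : ℝ) * t * Complex.I) with he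
  set ρ : ℝ → ℂ := fun t => g t - c / 2 - starRingEnd ℂ c / 2 * e t with hρ
  have hen : ∀ t, ‖e t‖ = 1 := fun t => by
    rw [he]
    simp only
    rw [← Complex.ofReal_mul, Complex.norm_exp_ofReal_mul_I]
  have hgc : ContinuousOn g (Set.Ioi 0) := by
    refine ContinuousOn.mul (Complex.continuous_ofReal.comp_continuousOn
      (Real.continuous_sqrt.continuousOn.mul (continuousOn_besselJ ν))) (by fun_prop)
  have hec : Continuous e := by fun_prop
  have hρc : ContinuousOn ρ (Set.Ioi 0) := by fun_prop
  have hgb : ∀ t, 0 < t → ‖g t‖ ≤ C := fun t ht => by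
    rw [hg]
    simp only
    rw [norm_mul, Complex.norm_exp_ofReal_mul_I, mul_one, Complex.norm_real, Real.norm_eq_abs,
      abs_mul, abs_of_nonneg (Real.sqrt_nonneg t)]
    exact (hJ t ht).2
  have hρb : ∀ t, 0 < t → ‖ρ t‖ ≤ C + ‖c‖ / 2 + ‖c‖ / 2 := fun t ht => by
    refine (norm_sub_le _ _).trans (add_le_add ((norm_sub_le _ _).trans
      (add_le_add (hgb t ht) ?_)) ?_)
    · rw [norm_div, Complex.norm_two]
    · rw [norm_mul, hen, mul_one, norm_div, Complex.norm_two, Complex.norm_conj]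
  have hρ0 : Tendsto ρ atTop (𝓝 0) := by
    have h0 : Tendsto (fun t => ‖besselAmp (besselJ ν) t - c‖) atTop (𝓝 0) := by
      simpa using (hc.sub_const c).norm
    refine squeeze_zero_norm (fun t => ?_) h0
    set A := besselAmp (besselJ ν) t
    have h1 : ((√t * besselJ ν t : ℝ) : ℂ) = (A * Complex.exp (-(t * Complex.I)) +
        starRingEnd ℂ A * Complex.exp (t * Complex.I)) / 2 := by
      rw [sqrt_mul_eq_re_besselAmp, Complex.re_eq_add_conj, map_mul, ← Complex.exp_conj]
      simp [A]
    have h2 : Complex.exp (-(t * Complex.I)) * Complex.exp (t * Complex.I) = 1 := by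
      rw [← Complex.exp_add]; simp
    have h3 : e t = Complex.exp (t * Complex.I) * Complex.exp (t * Complex.I) := by
      rw [he, ← Complex.exp_add]
      push_cast
      ring_nf
    have h4 : ρ t = (A - c) / 2 + starRingEnd ℂ (A - c) / 2 * e t := by
      simp only [hρ, hg, h1, map_sub]
      rw [h3]
      linear_combination (A / 2) * h2
    rw [h4]
    refine (norm_add_le _ _).trans_eq ?_
    rw [norm_mul, hen, norm_div, norm_div, Complex.norm_conj, Complex.norm_two]
    ring
  have hmap : ∀ {R : ℝ}, 0 < R → Set.MapsTo (fun s => R * s) (Set.Ioi 0) (Set.Ioi 0) :=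
    fun hR s (hs : 0 < s) => mul_pos hR hs
  have hwc : AEStronglyMeasurable w (volume.restrict (Set.Ioi 0)) := hwi.aestronglyMeasurable
  have hρm : ∀ {R : ℝ}, 0 < R →
      AEStronglyMeasurable (fun s => ρ (R * s)) (volume.restrict (Set.Ioi 0)) := fun hR =>
    (hρc.comp (by fun_prop) (hmap hR)).aestronglyMeasurable measurableSet_Ioi
  have t1 : Tendsto (fun R : ℝ => ∫ s in Set.Ioi (0 : ℝ), w s * ρ (R * s)) atTop (𝓝 0) := by
    rw [show (0 : ℂ) = ∫ s in Set.Ioi (0 : ℝ), (0 : ℂ) by simp]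
    refine tendsto_integral_filter_of_dominated_convergence
      (fun s => ‖w s‖ * (C + ‖c‖ / 2 + ‖c‖ / 2)) ?_ ?_ (hwi.norm.mul_const _) ?_
    · filter_upwards [eventually_gt_atTop 0] with R hR using hwc.mul (hρm hR)
    · filter_upwards [eventually_gt_atTop 0] with R hR
      filter_upwards [ae_restrict_mem measurableSet_Ioi] with s (hs : 0 < s)
      rw [norm_mul]
      exact mul_le_mul_of_nonneg_left (hρb _ (mul_pos hR hs)) (norm_nonneg _)
    · filter_upwards [ae_restrict_mem measurableSet_Ioi] with s (hs : 0 < s)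
      have := (hρ0.comp (tendsto_id.atTop_mul_const hs)).const_mul (w s)
      rwa [mul_zero] at this
  have t2 := tendsto_integral_exp_mul_I (fun s => w s * (starRingEnd ℂ c / 2)) two_ne_zero
  have t3 := (t1.add t2).add_const (∫ s in Set.Ioi (0 : ℝ), w s * (c / 2))
  rw [add_zero, zero_add, integral_mul_const, hwint, mul_comm] at t3
  refine t3.congr' ?_
  filter_upwards [eventually_gt_atTop 0] with R hR
  have i1 : IntegrableOn (fun s => w s * ρ (R * s)) (Set.Ioi 0) := by
    refine Integrable.mono' (hwi.norm.mul_const (C + ‖c‖ / 2 + ‖c‖ / 2)) (hwc.mul (hρm hR)) ?_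
    filter_upwards [ae_restrict_mem measurableSet_Ioi] with s (hs : 0 < s)
    rw [norm_mul]
    exact mul_le_mul_of_nonneg_left (hρb _ (mul_pos hR hs)) (norm_nonneg _)
  have i2 : IntegrableOn (fun s => w s * (starRingEnd ℂ c / 2) * e (R * s)) (Set.Ioi 0) := by
    refine Integrable.mono' (hwi.norm.mul_const ‖starRingEnd ℂ c / 2‖)
      ((hwc.mul_const _).mul (hec.comp (by fun_prop)).aestronglyMeasurable) ?_
    refine Eventually.of_forall fun s => ?_
    rw [norm_mul, hen, mul_one, norm_mul]
  have i3 : IntegrableOn (fun s => w s * (c / 2)) (Set.Ioi 0) := hwi.mul_const _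
  have e2 : ∫ s in Set.Ioi (0 : ℝ), w s * (starRingEnd ℂ c / 2) *
      Complex.exp ((2 : ℝ) * (R * s) * Complex.I) =
      ∫ s in Set.Ioi (0 : ℝ), w s * (starRingEnd ℂ c / 2) * e (R * s) := by
    congr 1 with s
    rw [he]
    push_cast
    rfl
  rw [e2, ← integral_add i1 i2, mul_comm, ← hwint, ← integral_mul_const,
    ← integral_add (f := fun s => w s * ρ (R * s) + w s * (starRingEnd ℂ c / 2) * e (R * s))
      (i1.add i2) i3]
  congr 1 with s
  change _ = w s * (g (R * s))
  simp only [hρ]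
  ring

lemma ofReal_mul_cpow {r : ℝ} (hr : 0 < r) {z : ℂ} (hz : z ≠ 0) (s : ℂ) :
    (r * z) ^ s = (r : ℂ) ^ s * z ^ s := by
  have hr' : (r : ℂ) ≠ 0 := Complex.ofReal_ne_zero.2 hr.ne'
  rw [Complex.cpow_def_of_ne_zero (mul_ne_zero hr' hz), Complex.cpow_def_of_ne_zero hr',
    Complex.cpow_def_of_ne_zero hz, Complex.log_ofReal_mul hr hz, add_mul, Complex.exp_add,
    Complex.ofReal_log hr.le]

lemma besselLaplace_eq_integral_sqrt_mul {ν R : ℝ} (hR : 0 < R) :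
    besselLaplace ν ν ((R : ℂ)⁻¹ - Complex.I) = (R : ℂ) ^ ((ν : ℂ) + 1 / 2) *
      ∫ s in Set.Ioi (0 : ℝ), ((s ^ (ν - 1 / 2) * Real.exp (-(1 * s)) : ℝ) : ℂ) *
      ((√(R * s) * besselJ ν (R * s) : ℝ) * Complex.exp ((R * s : ℝ) * Complex.I)) := by
  have h := integral_comp_mul_left_Ioi (fun t : ℝ => ((t ^ ν * besselJ ν t : ℝ) : ℂ) *
    Complex.exp (-(((R : ℂ)⁻¹ - Complex.I) * t))) 0 hR
  rw [mul_zero, Complex.real_smul, Complex.ofReal_inv,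
    eq_inv_mul_iff_mul_eq₀ (Complex.ofReal_ne_zero.2 hR.ne')] at h
  rw [besselLaplace, ← h, ← integral_const_mul, ← integral_const_mul]
  refine setIntegral_congr_fun measurableSet_Ioi fun s (hs : 0 < s) => ?_
  have hRs := mul_pos hR hs
  have e1 : (R : ℂ) ^ ((ν : ℂ) + 1 / 2) = ((R ^ (ν + 1 / 2) : ℝ) : ℂ) := by
    rw [Complex.ofReal_cpow hR.le]; push_cast; rfl
  have e2 : Complex.exp (-(((R : ℂ)⁻¹ - Complex.I) * (R * s : ℝ))) =
      ((Real.exp (-(1 * s)) : ℝ) : ℂ) * Complex.exp ((R * s : ℝ) * Complex.I) := by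
    have hR' : (R : ℂ) ≠ 0 := Complex.ofReal_ne_zero.2 hR.ne'
    rw [Complex.ofReal_exp, ← Complex.exp_add]
    congr 1
    push_cast
    field_simp
    ring
  have e3 : R * (R * s) ^ ν = R ^ (ν + 1 / 2) * s ^ (ν - 1 / 2) * √(R * s) := by
    rw [Real.sqrt_eq_rpow, Real.mul_rpow hR.le hs.le, Real.mul_rpow hR.le hs.le,
      show R ^ (ν + 1 / 2) * s ^ (ν - 1 / 2) * (R ^ (1 / 2 : ℝ) * s ^ (1 / 2 : ℝ)) =
        (R ^ (ν + 1 / 2) * R ^ (1 / 2 : ℝ)) * (s ^ (ν - 1 / 2) * s ^ (1 / 2 : ℝ)) by ring,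
      ← Real.rpow_add hR, ← Real.rpow_add hs, show ν + 1 / 2 + 1 / 2 = ν + 1 by ring,
      sub_add_cancel, Real.rpow_add hR, Real.rpow_one]
    ring
  have e4 := congrArg (fun r : ℝ => (r : ℂ)) e3
  simp only [Complex.ofReal_mul] at e4
  rw [e1, e2]
  simp only [Complex.ofReal_mul]
  linear_combination (besselJ ν (R * s) : ℂ) * ((Real.exp (-(1 * s)) : ℝ) : ℂ) *
    Complex.exp (R * s * Complex.I) * e4

lemma besselJ_amp_of_nonneg {ν : ℝ} (hν : 0 ≤ ν) :
    Tendsto (besselAmp (besselJ ν)) atTop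
      (𝓝 (√(2 / π) * Complex.exp ((ν * π / 2 + π / 4 : ℝ) * Complex.I))) := by
  obtain ⟨c, hc⟩ := (isCylinderFamily_besselJ.isBesselSolution ν).exists_tendsto_besselAmp
  convert hc
  set K := Real.Gamma (2 * ν + 1) * ((Real.Gamma (ν + 1))⁻¹ / 2 ^ ν) with hK
  have hI : (-(2 * Complex.I)) ∈ Complex.slitPlane := by
    rw [Complex.mem_slitPlane_iff]; right; simp
  have h1 : Tendsto (fun R : ℝ => ((R : ℂ)⁻¹ - 2 * Complex.I) ^ ((ν : ℂ) + 1 / 2)) atTop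
      (𝓝 ((-(2 * Complex.I)) ^ ((ν : ℂ) + 1 / 2))) := by
    refine (continuousAt_cpow_const hI).tendsto.comp ?_
    have : Tendsto (fun R : ℝ => (R : ℂ)⁻¹ - 2 * Complex.I) atTop (𝓝 (0 - 2 * Complex.I)) := by
      refine Tendsto.sub_const ?_ _
      have := (Complex.continuous_ofReal.tendsto _).comp tendsto_inv_atTop_zero
      simpa [Function.comp_def] using this
    rwa [zero_sub] at this
  have h2 := (tendsto_integral_sqrt_mul_besselJ hν hc).mul h1
  have h3 : c / 2 * Real.Gamma (ν + 1 / 2) * (-(2 * Complex.I)) ^ ((ν : ℂ) + 1 / 2) = K := by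
    refine tendsto_nhds_unique h2 (tendsto_const_nhds.congr' ?_)
    filter_upwards [eventually_gt_atTop 0] with R hR
    have hR' : (R : ℂ) ≠ 0 := Complex.ofReal_ne_zero.2 hR.ne'
    have h := besselLaplace_mul_cpow hν (p := (R : ℂ)⁻¹ - Complex.I)
      (by simpa [← Complex.ofReal_inv] using hR)
    have hne : (R : ℂ)⁻¹ - 2 * Complex.I ≠ 0 := by
      intro h0
      have := congrArg Complex.im h0
      simp [← Complex.ofReal_inv] at this
    rw [besselLaplace_eq_integral_sqrt_mul hR,
      show 1 + ((R : ℂ)⁻¹ - Complex.I) ^ 2 = ((R⁻¹ : ℝ) : ℂ) * ((R : ℂ)⁻¹ - 2 * Complex.I) by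
        push_cast; linear_combination Complex.I_sq,
      ofReal_mul_cpow (by positivity) hne, ← hK] at h
    rw [← h]
    have : (R : ℂ) ^ ((ν : ℂ) + 1 / 2) * ((R⁻¹ : ℝ) : ℂ) ^ ((ν : ℂ) + 1 / 2) = 1 := by
      rw [← Complex.mul_cpow_ofReal_nonneg hR.le (by positivity)]
      push_cast
      rw [mul_inv_cancel₀ hR', Complex.one_cpow]
    linear_combination ((∫ s in Set.Ioi (0 : ℝ),
      ((s ^ (ν - 1 / 2) * Real.exp (-(1 * s)) : ℝ) : ℂ) * ((√(R * s) * besselJ ν (R * s) : ℝ) *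
        Complex.exp ((R * s : ℝ) * Complex.I))) * ((R : ℂ)⁻¹ - 2 * Complex.I) ^
          ((ν : ℂ) + 1 / 2)) * this
  have h4 : (-(2 * Complex.I)) ^ ((ν : ℂ) + 1 / 2) = ((2 ^ (ν + 1 / 2) : ℝ) : ℂ) *
      Complex.exp (-((ν * π / 2 + π / 4 : ℝ) * Complex.I)) := by
    rw [show -(2 * Complex.I) = ((2 : ℝ) : ℂ) * (-Complex.I) by push_cast; ring,
      ofReal_mul_cpow two_pos (neg_ne_zero.2 Complex.I_ne_zero), Complex.ofReal_cpow two_pos.le,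
      Complex.cpow_def_of_ne_zero (neg_ne_zero.2 Complex.I_ne_zero), Complex.log_neg_I]
    push_cast
    congr 2
    ring
  have hG : 0 < Real.Gamma (ν + 1 / 2) := Real.Gamma_pos_of_pos (by linarith)
  have hG1 : 0 < Real.Gamma (ν + 1) := Real.Gamma_pos_of_pos (by linarith)
  have h5 : K = √(2 / π) / 2 * Real.Gamma (ν + 1 / 2) * 2 ^ (ν + 1 / 2) := by
    have hd := Real.Gamma_mul_Gamma_add_half (ν + 1 / 2)
    rw [show ν + 1 / 2 + 1 / 2 = ν + 1 by ring, show 2 * (ν + 1 / 2) = 2 * ν + 1 by ring,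
      show 1 - (2 * ν + 1) = -ν + -ν by ring, Real.rpow_add two_pos, Real.rpow_neg two_pos.le] at hd
    have hpi : 0 < √π := Real.sqrt_pos.2 pi_pos
    have h2ν : (0 : ℝ) < 2 ^ ν := Real.rpow_pos_of_pos two_pos _
    have hs2 : √2 * √2 = (2 : ℝ) := Real.mul_self_sqrt two_pos.le
    rw [hK, Real.rpow_add two_pos, ← Real.sqrt_eq_rpow, Real.sqrt_div two_pos.le]
    field_simp at hd ⊢
    rw [show √2 ^ 2 = (2 : ℝ) by rw [sq, hs2]]
    linarith
  rw [h4, h5] at h3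
  have hne : (((2 : ℝ) ^ (ν + 1 / 2) : ℝ) : ℂ) ≠ 0 :=
    Complex.ofReal_ne_zero.2 (Real.rpow_pos_of_pos two_pos _).ne'
  have hGne : ((Real.Gamma (ν + 1 / 2) : ℝ) : ℂ) ≠ 0 := Complex.ofReal_ne_zero.2 hG.ne'
  have h6 : Complex.exp (-((ν * π / 2 + π / 4 : ℝ) * Complex.I)) *
      Complex.exp ((ν * π / 2 + π / 4 : ℝ) * Complex.I) = 1 := by
    rw [← Complex.exp_add]; simp
  rw [Complex.ofReal_mul, Complex.ofReal_mul, Complex.ofReal_div, Complex.ofReal_ofNat] at h3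
  have h7 : (c * Complex.exp (-((ν * π / 2 + π / 4 : ℝ) * Complex.I)) - √(2 / π)) *
      (((Real.Gamma (ν + 1 / 2) : ℝ) : ℂ) * (((2 : ℝ) ^ (ν + 1 / 2) : ℝ) : ℂ)) = 0 := by
    linear_combination 2 * h3
  have h8 := (mul_eq_zero.1 h7).resolve_right (mul_ne_zero hGne hne)
  linear_combination (-Complex.exp ((ν * π / 2 + π / 4 : ℝ) * Complex.I)) * h8 + c * h6

lemma tendsto_besselAmp_besselJ (ν : ℝ) :
    Tendsto (besselAmp (besselJ ν)) atTop
      (𝓝 (√(2 / π) * Complex.exp ((ν * π / 2 + π / 4 : ℝ) * Complex.I))) := by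
  obtain ⟨n, hn⟩ := exists_nat_ge (-ν)
  induction n generalizing ν with
  | zero => exact besselJ_amp_of_nonneg (by simpa using hn)
  | succ n ih =>
    have h := ih (ν + 1) (by push_cast at hn; linarith)
    obtain ⟨c, hc⟩ := (isCylinderFamily_besselJ.isBesselSolution ν).exists_tendsto_besselAmp
    convert hc
    have e := isCylinderFamily_besselJ.amp_add_one hc h
    rw [show (((ν + 1) * π / 2 + π / 4 : ℝ) : ℂ) * Complex.I =
      ((ν * π / 2 + π / 4 : ℝ) : ℂ) * Complex.I + π / 2 * Complex.I by push_cast; ring,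
      Complex.exp_add, Complex.exp_pi_div_two_mul_I, ← mul_assoc] at e
    exact mul_right_cancel₀ Complex.I_ne_zero e

/-- The numerator in the definition of `besselY`. -/
noncomputable def besselYNum (ν x : ℝ) : ℝ := besselJ ν x * Real.cos (ν * π) - besselJ (-ν) x

/-- The analytic extension of `besselYNum` to complex order. -/
noncomputable def besselYNumC (s z : ℂ) : ℂ := besselJC s z * Complex.cos (s * π) - besselJC (-s) z

lemma ofReal_besselYNum (ν : ℝ) {x : ℝ} (hx : 0 < x) : (besselYNum ν x : ℂ) = besselYNumC ν x := by
  rw [besselYNum, besselYNumC, ← ofReal_besselJ ν hx, ← Complex.ofReal_neg,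
    ← ofReal_besselJ (-ν) hx]
  push_cast
  rfl

lemma besselYNum_recurrence (ν : ℝ) {x : ℝ} (hx : 0 < x) :
    x * (besselYNum (ν - 1) x + besselYNum (ν + 1) x) = -(2 * ν * besselYNum ν x) := by
  have h1 := isCylinderFamily_besselJ.recurrence ν x hx
  have h2 := isCylinderFamily_besselJ.recurrence (-ν) x hx
  rw [besselYNum, besselYNum, besselYNum, sub_mul ν, add_mul ν, one_mul, Real.cos_sub_pi,
    Real.cos_add_pi, show -(ν - 1) = -ν + 1 by ring, show -(ν + 1) = -ν - 1 by ring]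
  linear_combination (-Real.cos (ν * π)) * h1 - h2

lemma hasDerivAt_besselYNum (ν : ℝ) {x : ℝ} (hx : 0 < x) :
    HasDerivAt (besselYNum ν) ((besselYNum (ν + 1) x - besselYNum (ν - 1) x) / 2) x := by
  have h1 := isCylinderFamily_besselJ.hasDerivAt ν x hx
  have h2 := isCylinderFamily_besselJ.hasDerivAt (-ν) x hx
  refine ((h1.mul_const (Real.cos (ν * π))).sub h2).congr_deriv ?_
  rw [besselYNum, besselYNum, sub_mul ν, add_mul ν, one_mul, Real.cos_sub_pi,
    Real.cos_add_pi, show -(ν - 1) = -ν + 1 by ring, show -(ν + 1) = -ν - 1 by ring]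
  ring

lemma besselYNum_intCast (n : ℤ) {x : ℝ} (hx : 0 < x) : besselYNum n x = 0 := by
  have h0 : besselYNum 0 x = 0 := by simp [besselYNum]
  have h1 : besselYNum 1 x = 0 := by
    have := isCylinderFamily_besselJ.recurrence 0 x hx
    rw [zero_sub, zero_add, mul_zero, zero_mul, mul_eq_zero] at this
    have := this.resolve_left hx.ne'
    rw [besselYNum, one_mul, Real.cos_pi]
    linarith
  suffices h : besselYNum n x = 0 ∧ besselYNum (n + 1) x = 0 from h.1
  induction n using Int.induction_on with
  | zero => simpa using ⟨h0, h1⟩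
  | succ n ih =>
    have := besselYNum_recurrence ((n : ℝ) + 1) hx
    push_cast at ih ⊢
    rw [add_sub_cancel_right, ih.1, ih.2, mul_zero, neg_zero, zero_add, mul_eq_zero] at this
    exact ⟨ih.2, this.resolve_left hx.ne'⟩
  | pred n ih =>
    have := besselYNum_recurrence (-n : ℝ) hx
    push_cast at ih ⊢
    rw [ih.1, ih.2, mul_zero, neg_zero, add_zero, mul_eq_zero] at this
    rw [sub_add_cancel]
    exact ⟨this.resolve_left hx.ne', ih.1⟩

lemma differentiable_besselYNumC_left {z : ℂ} (hz : z ≠ 0) :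
    Differentiable ℂ fun s => besselYNumC s z := by
  have h := differentiable_besselJC_left hz
  have h2 : Differentiable ℂ fun s : ℂ => Complex.cos (s * π) := by fun_prop
  exact (h.mul h2).sub (h.comp differentiable_neg)

lemma exists_norm_besselJC_le (R : ℝ) {a b : ℝ} (ha : 0 < a) :
    ∃ C, 0 ≤ C ∧ ∀ s : ℂ, ‖s‖ ≤ R → ∀ x ∈ Set.Icc a b, ‖besselJC s x‖ ≤ C := by
  obtain ⟨C, hC, h⟩ := exists_norm_besselSeries_le R
  set L := max |Real.log (a / 2)| |Real.log (b / 2)|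
  refine ⟨Real.exp (L * R) * (C * Real.exp (b ^ 2 / 4)), by positivity, fun s hs x hx => ?_⟩
  have hx0 : 0 < x := ha.trans_le hx.1
  rw [besselJC, norm_mul]
  refine mul_le_mul ?_ ((h _ _ hs).trans ?_) (norm_nonneg _) (Real.exp_pos _).le
  · rw [show (x : ℂ) / 2 = ((x / 2 : ℝ) : ℂ) by push_cast; rfl,
      Complex.norm_cpow_eq_rpow_re_of_pos (by positivity), Real.rpow_def_of_pos (by positivity)]
    refine Real.exp_le_exp.2 ((le_abs_self _).trans ?_)
    rw [abs_mul]
    refine mul_le_mul (abs_le_max_abs_abs ?_ ?_) ((Complex.abs_re_le_norm s).trans hs)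
      (abs_nonneg _) (le_max_of_le_left (abs_nonneg _))
    · exact Real.log_le_log (by positivity) (by linarith [hx.1])
    · exact Real.log_le_log (by positivity) (by linarith [hx.2])
  · refine mul_le_mul_of_nonneg_left (Real.exp_le_exp.2 ?_) hC
    rw [norm_div, norm_pow, Complex.norm_real, Real.norm_of_nonneg hx0.le]
    norm_num
    have := pow_le_pow_left₀ hx0.le hx.2 2
    linarith

lemma exists_norm_besselYNumC_le (R : ℝ) {a b : ℝ} (ha : 0 < a) :
    ∃ C, 0 ≤ C ∧ ∀ s : ℂ, ‖s‖ ≤ R → ∀ x ∈ Set.Icc a b, ‖besselYNumC s x‖ ≤ C := by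
  obtain ⟨C, hC, h⟩ := exists_norm_besselJC_le R (b := b) ha
  obtain ⟨B, hB⟩ := (isCompact_closedBall (0 : ℂ) R).exists_bound_of_continuousOn
    (f := fun s => Complex.cos (s * π)) (by fun_prop)
  refine ⟨C * |B| + C, by positivity, fun s hs x hx => ?_⟩
  refine (norm_sub_le _ _).trans (add_le_add ?_ (h _ (by rwa [norm_neg]) x hx))
  rw [norm_mul]
  exact mul_le_mul (h s hs x hx) ((hB s (by simpa using hs)).trans (le_abs_self B))
    (norm_nonneg _) hC

/-- The derivative of `besselYNum` with respect to the order. -/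
noncomputable def besselYNumDeriv (ν x : ℝ) : ℝ := (deriv (fun s => besselYNumC s x) ν).re

lemma hasDerivAt_besselYNum_left (ν : ℝ) {x : ℝ} (hx : 0 < x) :
    HasDerivAt (fun ν => besselYNum ν x) (besselYNumDeriv ν x) ν := by
  have h := (differentiable_besselYNumC_left (Complex.ofReal_ne_zero.2 hx.ne')).differentiableAt
    (x := (ν : ℂ)) |>.hasDerivAt.real_of_complex
  refine h.congr_of_eventuallyEq (Eventually.of_forall fun μ => ?_)
  simp only
  rw [← ofReal_besselYNum μ hx, Complex.ofReal_re]

lemma exists_abs_besselYNum_div_sub_le (n : ℤ) {a b : ℝ} (ha : 0 < a) :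
    ∃ C, 0 ≤ C ∧ ∀ x ∈ Set.Icc a b, ∀ h : ℝ, h ≠ 0 → |h| < 1 →
      |besselYNum (n + h) x / h - besselYNumDeriv n x| ≤ C * |h| := by
  obtain ⟨C, hC, hb⟩ := exists_norm_besselYNumC_le (|(n : ℝ)| + 1) (b := b) ha
  refine ⟨C + C, by positivity, fun x hx h h0 h1 => ?_⟩
  have hx0 : 0 < x := ha.trans_le hx.1
  set f : ℂ → ℂ := fun s => besselYNumC s x with hf
  have hfn : f n = 0 := by
    have := besselYNum_intCast n hx0
    rw [hf]
    simp only
    rw [show (n : ℂ) = ((n : ℝ) : ℂ) by push_cast; rfl, ← ofReal_besselYNum _ hx0, this,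
      Complex.ofReal_zero]
  have hfd : DifferentiableOn ℂ f (Metric.ball n 1) :=
    (differentiable_besselYNumC_left (Complex.ofReal_ne_zero.2 hx0.ne')).differentiableOn
  have hmaps : Set.MapsTo f (Metric.ball (n : ℂ) 1) (Metric.closedBall (f n) C) := by
    intro s hs
    rw [hfn, mem_closedBall_zero_iff]
    refine hb s ?_ x hx
    rw [Metric.mem_ball, dist_eq_norm] at hs
    have h2 : ‖s‖ ≤ ‖(n : ℂ)‖ + ‖s - n‖ := by
      simpa using norm_add_le (n : ℂ) (s - n)
    have h3 : ‖(n : ℂ)‖ = |(n : ℝ)| := by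
      rw [show (n : ℂ) = ((n : ℝ) : ℂ) by push_cast; rfl, Complex.norm_real, Real.norm_eq_abs]
    linarith
  have hgb : ∀ s ∈ Metric.ball (n : ℂ) 1, ‖dslope f n s‖ ≤ C := fun s hs => by
    simpa using Complex.norm_dslope_le_div_of_mapsTo_ball hfd hmaps hs
  have hgd : DifferentiableOn ℂ (dslope f n) (Metric.ball n 1) :=
    (Complex.differentiableOn_dslope (Metric.ball_mem_nhds _ one_pos)).2 hfd
  have hmem : (n + h : ℂ) ∈ Metric.ball (n : ℂ) 1 := by
    simpa [dist_eq_norm] using h1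
  have key := Complex.dist_le_div_mul_dist_of_mapsTo_ball (R₂ := C + C) hgd (fun s hs => by
    rw [Metric.mem_closedBall]
    exact (dist_le_norm_add_norm _ _).trans (add_le_add (hgb s hs)
      (hgb _ (Metric.mem_ball_self one_pos)))) hmem
  have hne : (n + h : ℂ) ≠ n := by simpa using h0
  rw [dslope_same, dslope_of_ne _ hne, slope_def_field, hfn, sub_zero, add_sub_cancel_left,
    dist_eq_norm, dist_eq_norm, add_sub_cancel_left, Complex.norm_real, Real.norm_eq_abs,
    div_one] at key
  refine le_trans ?_ key
  refine le_trans (le_of_eq ?_) (Complex.abs_re_le_norm _)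
  rw [Complex.sub_re, besselYNumDeriv, Complex.ofReal_intCast]
  congr 2
  rw [hf]
  simp only
  rw [show (n + h : ℂ) = ((n + h : ℝ) : ℂ) by push_cast; rfl, ← ofReal_besselYNum _ hx0,
    ← Complex.ofReal_div, Complex.ofReal_re]

lemma hasDerivAt_besselYNumDeriv (n : ℤ) {x : ℝ} (hx : 0 < x) :
    HasDerivAt (besselYNumDeriv n)
      ((besselYNumDeriv ((n + 1 : ℤ)) x - besselYNumDeriv ((n - 1 : ℤ)) x) / 2) x := by
  have hx2 : 0 < x / 2 := by positivity
  have hlim : ∀ (m : ℤ) (y : ℝ), 0 < y → Tendsto (fun h => besselYNum (m + h) y / h) (𝓝[≠] 0)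
      (𝓝 (besselYNumDeriv m y)) := fun m y hy => by
    have h := (hasDerivAt_besselYNum_left m hy).tendsto_slope_zero
    simp only [besselYNum_intCast m hy, sub_zero, smul_eq_mul] at h
    exact h.congr fun t => by rw [div_eq_inv_mul]
  have hev : ∀ᶠ h : ℝ in 𝓝[≠] 0, h ≠ 0 ∧ |h| < 1 := by
    refine eventually_mem_nhdsWithin.and (nhdsWithin_le_nhds ?_)
    filter_upwards [Metric.ball_mem_nhds (0 : ℝ) one_pos] with h hh
    simpa using hh
  refine hasDerivAt_of_tendstoUniformlyOn (l := 𝓝[≠] (0 : ℝ)) (s := Set.Ioo (x / 2) (2 * x))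
    (f := fun h y => besselYNum (n + h) y / h)
    (f' := fun h y => (besselYNum (n + h + 1) y - besselYNum (n + h - 1) y) / 2 / h)
    (g' := fun y => (besselYNumDeriv ((n + 1 : ℤ)) y - besselYNumDeriv ((n - 1 : ℤ)) y) / 2)
    isOpen_Ioo ?_ ?_ ?_ ⟨by linarith, by linarith⟩
  · obtain ⟨C, hC, h1⟩ := exists_abs_besselYNum_div_sub_le (n + 1) (b := 2 * x) hx2
    obtain ⟨C', hC', h2⟩ := exists_abs_besselYNum_div_sub_le (n - 1) (b := 2 * x) hx2
    rw [Metric.tendstoUniformlyOn_iff]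
    intro ε hε
    have h0 : Tendsto (fun h : ℝ => (C + C') * |h|) (𝓝[≠] 0) (𝓝 0) := by
      have : Continuous fun h : ℝ => (C + C') * |h| := by fun_prop
      simpa using this.continuousAt (x := 0) |>.tendsto.mono_left nhdsWithin_le_nhds
    filter_upwards [hev, h0.eventually_lt_const hε] with h ⟨hh, hh1⟩ hhε y hy
    have e1 := h1 y (Set.Ioo_subset_Icc_self hy) h hh hh1
    have e2 := h2 y (Set.Ioo_subset_Icc_self hy) h hh hh1
    rw [dist_comm, Real.dist_eq]
    refine lt_of_le_of_lt ?_ hhε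
    push_cast at e1 e2 ⊢
    rw [show (n : ℝ) + 1 + h = n + h + 1 by ring] at e1
    rw [show (n : ℝ) - 1 + h = n + h - 1 by ring] at e2
    rw [show (besselYNum (n + h + 1) y - besselYNum (n + h - 1) y) / 2 / h -
        (besselYNumDeriv (n + 1) y - besselYNumDeriv (n - 1) y) / 2 =
        (besselYNum (n + h + 1) y / h - besselYNumDeriv (n + 1) y) / 2 -
        (besselYNum (n + h - 1) y / h - besselYNumDeriv (n - 1) y) / 2 by ring]
    refine (abs_sub _ _).trans ?_
    rw [abs_div, abs_div, abs_two]
    nlinarith [abs_nonneg h]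
  · exact Eventually.of_forall fun h y hy =>
      (hasDerivAt_besselYNum (n + h) (hx2.trans hy.1)).div_const h
  · exact fun y hy => hlim n y (hx2.trans hy.1)

lemma neBot_nhdsWithin_ne_intCast (ν : ℝ) :
    (𝓝[{μ : ℝ | ∀ n : ℤ, μ ≠ (n : ℝ)}] ν).NeBot := by
  rw [← mem_closure_iff_nhdsWithin_neBot]
  have h : Dense (Set.range ((↑) : ℤ → ℝ))ᶜ := (Set.countable_range _).dense_compl ℝ
  convert h ν using 2
  ext μ
  simp [eq_comm]

lemma eventually_ne_intCast (ν : ℝ) : ∀ᶠ μ in 𝓝[≠] ν, ∀ n : ℤ, μ ≠ (n : ℝ) := by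
  have h : Set.Ioo ((⌈ν⌉ : ℝ) - 1) (⌊ν⌋ + 1) ∈ 𝓝 ν :=
    Ioo_mem_nhds (by linarith [Int.ceil_lt_add_one ν]) (Int.lt_floor_add_one ν)
  filter_upwards [eventually_mem_nhdsWithin, nhdsWithin_le_nhds h] with μ hμ hI n hn
  subst hn
  have h1 : ⌈ν⌉ - 1 < n := by exact_mod_cast hI.1
  have h2 : n < ⌊ν⌋ + 1 := by exact_mod_cast hI.2
  refine hμ (le_antisymm ?_ ?_)
  · exact (Int.le_floor.1 (by omega))
  · exact (Int.ceil_le.1 (by omega))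

lemma sin_mul_pi_ne_zero {ν : ℝ} (hν : ∀ n : ℤ, ν ≠ (n : ℝ)) : Real.sin (ν * π) ≠ 0 := by
  rw [Ne, Real.sin_eq_zero_iff]
  rintro ⟨n, hn⟩
  exact hν n (mul_right_cancel₀ pi_ne_zero hn.symm)

lemma continuous_besselYNum_left {x : ℝ} (hx : 0 < x) : Continuous fun ν => besselYNum ν x :=
  continuous_iff_continuousAt.2 fun ν => (hasDerivAt_besselYNum_left ν hx).continuousAt

lemma besselY_eq_div {ν : ℝ} (hν : ∀ n : ℤ, ν ≠ (n : ℝ)) {x : ℝ} (hx : 0 < x) :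
    besselY ν x = besselYNum ν x / Real.sin (ν * π) := by
  have := neBot_nhdsWithin_ne_intCast ν
  refine Tendsto.limUnder_eq (Tendsto.mono_left ?_ nhdsWithin_le_nhds)
  exact ((continuous_besselYNum_left hx).continuousAt (x := ν)).tendsto.div
    ((by fun_prop : Continuous fun μ : ℝ => Real.sin (μ * π)).continuousAt.tendsto)
    (sin_mul_pi_ne_zero hν)

lemma tendsto_besselYNum_div_sin (n : ℤ) {x : ℝ} (hx : 0 < x) :
    Tendsto (fun μ => besselYNum μ x / Real.sin (μ * π)) (𝓝[≠] (n : ℝ))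
      (𝓝 (besselYNumDeriv n x / (Real.cos (n * π) * π))) := by
  have h1 := (hasDerivAt_besselYNum_left n hx).tendsto_slope
  have h2 : HasDerivAt (fun μ : ℝ => Real.sin (μ * π)) (Real.cos (n * π) * π) n := by
    simpa using ((hasDerivAt_id (n : ℝ)).mul_const π).sin
  have hc : Real.cos (n * π) * π ≠ 0 := by
    refine mul_ne_zero (fun h => ?_) pi_ne_zero
    have := Real.sin_sq_add_cos_sq (n * π)
    rw [Real.sin_int_mul_pi, h] at this
    norm_num at this
  refine (h1.div h2.tendsto_slope hc).congr' ?_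
  filter_upwards [eventually_mem_nhdsWithin] with μ hμ
  rw [Pi.div_apply, slope_def_field, slope_def_field, besselYNum_intCast n hx,
    Real.sin_int_mul_pi, sub_zero,
    sub_zero]
  exact div_div_div_cancel_right₀ (sub_ne_zero.2 hμ) _ _

lemma besselY_intCast (n : ℤ) {x : ℝ} (hx : 0 < x) :
    besselY n x = besselYNumDeriv n x / (Real.cos (n * π) * π) := by
  have := neBot_nhdsWithin_ne_intCast n
  exact Tendsto.limUnder_eq ((tendsto_besselYNum_div_sin n hx).mono_left
    (nhdsWithin_mono _ fun μ hμ => hμ n))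

lemma continuous_besselY_left {x : ℝ} (hx : 0 < x) : Continuous fun ν => besselY ν x := by
  refine continuous_iff_continuousAt.2 fun ν => continuousAt_iff_punctured_nhds.2 ?_
  suffices h : Tendsto (fun μ => besselYNum μ x / Real.sin (μ * π)) (𝓝[≠] ν)
      (𝓝 (besselY ν x)) by
    refine h.congr' ?_
    filter_upwards [eventually_ne_intCast ν] with μ hμ using (besselY_eq_div hμ hx).symm
  by_cases hν : ∀ n : ℤ, ν ≠ (n : ℝ)
  · rw [besselY_eq_div hν hx]
    exact (((continuous_besselYNum_left hx).continuousAt (x := ν)).tendsto.div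
      ((by fun_prop : Continuous fun μ : ℝ => Real.sin (μ * π)).continuousAt.tendsto)
      (sin_mul_pi_ne_zero hν)).mono_left nhdsWithin_le_nhds
  · push Not at hν
    obtain ⟨n, rfl⟩ := hν
    rw [besselY_intCast n hx]
    exact tendsto_besselYNum_div_sin n hx

lemma isCylinderFamily_besselY : IsCylinderFamily besselY where
  hasDerivAt ν x hx := by
    by_cases hν : ∀ n : ℤ, ν ≠ (n : ℝ)
    · have h1 : ∀ n : ℤ, ν + 1 ≠ (n : ℝ) := fun n hn => hν (n - 1) (by push_cast; linarith)
      have h2 : ∀ n : ℤ, ν - 1 ≠ (n : ℝ) := fun n hn => hν (n + 1) (by push_cast; linarith)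
      have h := (hasDerivAt_besselYNum ν hx).div_const (Real.sin (ν * π))
      refine (h.congr_deriv ?_).congr_of_eventuallyEq ?_
      · rw [besselY_eq_div h1 hx, besselY_eq_div h2 hx, sub_mul ν, add_mul ν, one_mul,
          Real.sin_sub_pi, Real.sin_add_pi, div_neg, div_neg]
        ring
      · filter_upwards [Ioi_mem_nhds hx] with y hy using besselY_eq_div hν hy
    · push Not at hν
      obtain ⟨n, rfl⟩ := hν
      have h := (hasDerivAt_besselYNumDeriv n hx).div_const (Real.cos (n * π) * π)
      refine (h.congr_deriv ?_).congr_of_eventuallyEq ?_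
      · rw [show (n : ℝ) - 1 = ((n - 1 : ℤ) : ℝ) by push_cast; rfl,
          show (n : ℝ) + 1 = ((n + 1 : ℤ) : ℝ) by push_cast; rfl, besselY_intCast _ hx,
          besselY_intCast _ hx]
        push_cast
        rw [sub_mul, add_mul, one_mul, Real.cos_sub_pi, Real.cos_add_pi, neg_mul, div_neg, div_neg]
        ring
      · filter_upwards [Ioi_mem_nhds hx] with y hy using besselY_intCast n hy
  recurrence ν x hx := by
    have hc := continuous_besselY_left hx
    have hcl : ContinuousAt (fun ν => x * (besselY (ν - 1) x + besselY (ν + 1) x)) ν := by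
      have h1 : Continuous fun ν => besselY (ν - 1) x := hc.comp (continuous_sub_right 1)
      have h2 : Continuous fun ν => besselY (ν + 1) x := hc.comp (continuous_add_const 1)
      fun_prop
    have hcr : ContinuousAt (fun ν => 2 * ν * besselY ν x) ν := by fun_prop
    refine tendsto_nhds_unique (hcl.tendsto.mono_left (nhdsWithin_le_nhds (s := {ν}ᶜ)))
      ((hcr.tendsto.mono_left nhdsWithin_le_nhds).congr' ?_)
    filter_upwards [eventually_ne_intCast ν] with μ hμ
    have h1 : ∀ n : ℤ, μ + 1 ≠ (n : ℝ) := fun n hn => hμ (n - 1) (by push_cast; linarith)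
    have h2 : ∀ n : ℤ, μ - 1 ≠ (n : ℝ) := fun n hn => hμ (n + 1) (by push_cast; linarith)
    rw [besselY_eq_div h1 hx, besselY_eq_div h2 hx, besselY_eq_div hμ hx, sub_mul μ, add_mul μ,
      one_mul, Real.sin_sub_pi, Real.sin_add_pi, div_neg, div_neg]
    have := besselYNum_recurrence μ hx
    have hs := sin_mul_pi_ne_zero hμ
    field_simp
    linarith

/-- The limit of `besselAmp (besselJ ν)` at infinity. -/
noncomputable def besselJAmp (ν : ℝ) : ℂ :=
  √(2 / π) * Complex.exp ((ν * π / 2 + π / 4 : ℝ) * Complex.I)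

lemma IsCylinderFamily.continuous_deriv_left {u : ℝ → ℝ → ℝ} (hu : IsCylinderFamily u) {x : ℝ}
    (hx : 0 < x) (hc : Continuous fun ν => u ν x) : Continuous fun ν => deriv (u ν) x := by
  have h1 : Continuous fun ν => u (ν - 1) x := hc.comp (continuous_sub_right 1)
  have h2 : Continuous fun ν => u (ν + 1) x := hc.comp (continuous_add_const 1)
  simp_rw [fun ν => (hu.hasDerivAt ν x hx).deriv]
  fun_prop

lemma tendsto_besselAmp_besselY_of_ne_intCast {ν : ℝ} (hν : ∀ n : ℤ, ν ≠ (n : ℝ)) :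
    Tendsto (besselAmp (besselY ν)) atTop (𝓝 (besselJAmp ν * Complex.I)) := by
  have hs := sin_mul_pi_ne_zero hν
  have hsC : (Real.sin (ν * π) : ℂ) ≠ 0 := Complex.ofReal_ne_zero.2 hs
  have h1 : Tendsto (besselAmp (besselJ ν)) atTop (𝓝 (besselJAmp ν)) := tendsto_besselAmp_besselJ ν
  have h2 : Tendsto (besselAmp (besselJ (-ν))) atTop (𝓝 (besselJAmp (-ν))) :=
    tendsto_besselAmp_besselJ (-ν)
  have h3 := ((h1.mul_const (Real.cos (ν * π) : ℂ)).sub h2).div_const (Real.sin (ν * π) : ℂ)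
  have e : (besselJAmp ν * (Real.cos (ν * π) : ℂ) - besselJAmp (-ν)) / (Real.sin (ν * π) : ℂ) =
      besselJAmp ν * Complex.I := by
    rw [div_eq_iff hsC, besselJAmp, besselJAmp]
    set A := Complex.exp ((-ν * π / 2 + π / 4 : ℝ) * Complex.I)
    have hA : Complex.exp ((ν * π / 2 + π / 4 : ℝ) * Complex.I) =
        A * ((Real.cos (ν * π) : ℂ) + (Real.sin (ν * π) : ℂ) * Complex.I) := by
      rw [Complex.ofReal_cos, Complex.ofReal_sin, ← Complex.exp_mul_I, ← Complex.exp_add]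
      congr 1
      push_cast
      ring
    have hcs : (Real.sin (ν * π) : ℂ) ^ 2 + (Real.cos (ν * π) : ℂ) ^ 2 = 1 := by
      exact_mod_cast Real.sin_sq_add_cos_sq (ν * π)
    rw [hA]
    linear_combination (√(2 / π) * A : ℂ) * hcs -
      (√(2 / π) * A * (Real.sin (ν * π) : ℂ) ^ 2 : ℂ) * Complex.I_sq
  rw [e] at h3
  refine h3.congr' ?_
  filter_upwards [eventually_gt_atTop 0] with x hx
  have hd : deriv (besselY ν) x =
      (deriv (besselJ ν) x * Real.cos (ν * π) - deriv (besselJ (-ν)) x) / Real.sin (ν * π) := by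
    have d1 := (isCylinderFamily_besselJ.isBesselSolution ν).hasDerivAt x hx
    have d2 := (isCylinderFamily_besselJ.isBesselSolution (-ν)).hasDerivAt x hx
    refine HasDerivAt.deriv ((((d1.mul_const _).sub d2).div_const _).congr_of_eventuallyEq ?_)
    filter_upwards [Ioi_mem_nhds hx] with y hy using besselY_eq_div hν hy
  unfold besselAmp
  rw [hd, besselY_eq_div hν hx, besselYNum]
  push_cast
  field_simp
  ring

lemma tendsto_besselAmp_besselY (ν : ℝ) :
    Tendsto (besselAmp (besselY ν)) atTop (𝓝 (besselJAmp ν * Complex.I)) := by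
  have hamp : ∀ {x : ℝ}, 0 < x → Continuous fun μ => besselAmp (besselY μ) x := fun hx => by
    have h1 := continuous_besselY_left hx
    have h2 := isCylinderFamily_besselY.continuous_deriv_left hx h1
    unfold besselAmp
    fun_prop
  have hJ : Continuous besselJAmp := by
    unfold besselJAmp
    fun_prop
  have key : ∀ x : ℝ, 1 ≤ x → ‖besselJAmp ν * Complex.I - besselAmp (besselY ν) x‖ ≤
      |ν ^ 2 - 1 / 4| * (Real.exp |ν ^ 2 - 1 / 4| * ‖besselAmp (besselY ν) 1‖) / x := by
    intro x hx
    have hx0 : 0 < x := zero_lt_one.trans_le hx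
    have c1 := hamp hx0
    have c2 := hamp one_pos
    have l1 : Continuous fun ν => ‖besselJAmp ν * Complex.I - besselAmp (besselY ν) x‖ := by
      fun_prop
    have l2 : Continuous fun ν : ℝ =>
        |ν ^ 2 - 1 / 4| * (Real.exp |ν ^ 2 - 1 / 4| * ‖besselAmp (besselY ν) 1‖) / x := by
      fun_prop
    refine le_of_tendsto_of_tendsto (l1.continuousAt.tendsto.mono_left
      (nhdsWithin_le_nhds (s := {ν}ᶜ))) (l2.continuousAt.tendsto.mono_left nhdsWithin_le_nhds) ?_
    filter_upwards [eventually_ne_intCast ν] with μ hμ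
    exact (isCylinderFamily_besselY.isBesselSolution μ).norm_sub_besselAmp_le
      (tendsto_besselAmp_besselY_of_ne_intCast hμ) hx
  rw [tendsto_iff_norm_sub_tendsto_zero]
  refine squeeze_zero' (Eventually.of_forall fun _ => norm_nonneg _) ?_
    ((tendsto_const_nhds (x := |ν ^ 2 - 1 / 4| * (Real.exp |ν ^ 2 - 1 / 4| *
      ‖besselAmp (besselY ν) 1‖))).div_atTop tendsto_id)
  filter_upwards [eventually_ge_atTop 1] with x hx
  rw [norm_sub_rev]
  exact key x hx

lemma conj_besselJAmp_mul (ν μ : ℝ) : starRingEnd ℂ (besselJAmp ν) * besselJAmp μ =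
    (2 / π : ℝ) * Complex.exp (((μ - ν) * (π / 2) : ℝ) * Complex.I) := by
  have h : ((√(2 / π) : ℝ) : ℂ) * ((√(2 / π) : ℝ) : ℂ) = (2 / π : ℝ) := by
    rw [← Complex.ofReal_mul, Real.mul_self_sqrt (by positivity)]
  rw [besselJAmp, besselJAmp, map_mul, Complex.conj_ofReal, ← Complex.exp_conj, mul_mul_mul_comm, h,
    ← Complex.exp_add, map_mul, Complex.conj_ofReal, Complex.conj_I]
  congr 2
  push_cast
  ring

lemma tendsto_mul_wronskian_besselJ_besselY (ν μ : ℝ) :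
    Tendsto (fun x => x * (besselJ ν x * deriv (besselY μ) x - deriv (besselJ ν) x * besselY μ x))
      atTop (𝓝 (2 / π * Real.cos ((μ - ν) * (π / 2)))) := by
  convert tendsto_mul_wronskian (tendsto_besselAmp_besselJ ν) (tendsto_besselAmp_besselY μ) using 2
  rw [← besselJAmp, ← mul_assoc, conj_besselJAmp_mul, mul_assoc, Complex.im_ofReal_mul,
    Complex.mul_I_im, Complex.exp_ofReal_mul_I_re]

lemma mul_wronskian_besselJ_besselY (ν : ℝ) {x : ℝ} (hx : 0 < x) :
    x * (besselJ ν x * deriv (besselY ν) x - deriv (besselJ ν) x * besselY ν x) = 2 / π := by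
  have hd : ∀ y ∈ Set.Ioi (0 : ℝ), HasDerivAt (fun x => x * (besselJ ν x * deriv (besselY ν) x -
      deriv (besselJ ν) x * besselY ν x)) 0 y := fun y hy => by
    simpa using (isCylinderFamily_besselJ.isBesselSolution ν).hasDerivAt_mul_wronskian
      (isCylinderFamily_besselY.isBesselSolution ν) hy
  have h := tendsto_mul_wronskian_besselJ_besselY ν ν
  rw [sub_self, zero_mul, Real.cos_zero, mul_one] at h
  refine tendsto_nhds_unique (tendsto_const_nhds.congr' ?_) h
  filter_upwards [eventually_gt_atTop 0] with y hy
  exact isOpen_Ioi.is_const_of_deriv_eq_zero isPreconnected_Ioi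
    (fun y hy => (hd y hy).differentiableAt.differentiableWithinAt)
    (fun y hy => (hd y hy).deriv) hx hy

lemma tendsto_atBot_of_div_le_deriv {f f' : ℝ → ℝ} {c : ℝ} (hc : 0 < c)
    (hf : ∀ᶠ x in 𝓝[>] 0, HasDerivAt f (f' x) x) (hf' : ∀ᶠ x in 𝓝[>] 0, c / x ≤ f' x) :
    Tendsto f (𝓝[>] 0) atBot := by
  obtain ⟨δ, hδ, h⟩ := mem_nhdsGT_iff_exists_Ioc_subset.1 (hf.and hf')
  have hd : ∀ x ∈ Set.Ioc 0 δ, HasDerivAt (fun x => f x - c * Real.log x) (f' x - c * x⁻¹) x :=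
    fun x hx => (h hx).1.sub ((Real.hasDerivAt_log hx.1.ne').const_mul c)
  have hm : MonotoneOn (fun x => f x - c * Real.log x) (Set.Ioc 0 δ) := by
    refine monotoneOn_of_deriv_nonneg (convex_Ioc 0 δ)
      (fun x hx => (hd x hx).continuousAt.continuousWithinAt)
      (fun x hx => (hd x (interior_subset hx)).differentiableAt.differentiableWithinAt)
      fun x hx => ?_
    rw [(hd x (interior_subset hx)).deriv, ← div_eq_mul_inv, sub_nonneg]
    exact (h (interior_subset hx)).2
  have hl : Tendsto (fun x => (f δ - c * Real.log δ) + c * Real.log x) (𝓝[>] 0) atBot :=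
    tendsto_atBot_add_const_left _ _ (Real.tendsto_log_nhdsGT_zero.const_mul_atBot hc)
  refine tendsto_atBot_mono' _ ?_ hl
  filter_upwards [Ioc_mem_nhdsGT hδ] with x hx
  have := hm hx ⟨hδ, le_rfl⟩ hx.2
  simp only at this
  linarith

lemma eventually_pos_of_tendsto_zero {f f' : ℝ → ℝ} (h0 : Tendsto f (𝓝[>] 0) (𝓝 0))
    (hf : ∀ᶠ x in 𝓝[>] 0, HasDerivAt f (f' x) x) (hf' : ∀ᶠ x in 𝓝[>] 0, 0 < f' x) :
    ∀ᶠ x in 𝓝[>] 0, 0 < f x := by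
  obtain ⟨δ, hδ, h⟩ := mem_nhdsGT_iff_exists_Ioc_subset.1 (hf.and hf')
  have hm : StrictMonoOn f (Set.Ioc 0 δ) := by
    refine strictMonoOn_of_deriv_pos (convex_Ioc 0 δ)
      (fun x hx => (h hx).1.continuousAt.continuousWithinAt) fun x hx => ?_
    rw [(h (interior_subset hx)).1.deriv]
    exact (h (interior_subset hx)).2
  filter_upwards [Ioc_mem_nhdsGT hδ] with x hx
  have hx0 : 0 < x := hx.1
  have h2 : x / 2 ∈ Set.Ioc 0 δ := ⟨by linarith, by linarith [hx.2]⟩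
  refine lt_of_le_of_lt ?_ (hm h2 hx (by linarith))
  refine le_of_tendsto h0 ?_
  filter_upwards [Ioc_mem_nhdsGT h2.1] with y hy
  exact hm.monotoneOn ⟨hy.1, hy.2.trans h2.2⟩ h2 hy.2

lemma eventually_besselJ_pos {ν : ℝ} (hν : 0 ≤ ν) : ∀ᶠ x in 𝓝[>] 0, 0 < besselJ ν x := by
  have hG : 0 < Real.Gamma (ν + 1) := Real.Gamma_pos_of_pos (by linarith)
  filter_upwards [(tendsto_besselJ_div_rpow ν).eventually_const_lt (u := 0) (by positivity),
    eventually_mem_nhdsWithin] with x hx hx0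
  exact (div_pos_iff_of_pos_right (Real.rpow_pos_of_pos hx0 ν)).1 hx

lemma tendsto_besselJ_zero {ν : ℝ} (hν : 0 ≤ ν) :
    Tendsto (besselJ ν) (𝓝[>] 0) (𝓝 (0 ^ ν * ((Real.Gamma (ν + 1))⁻¹ / 2 ^ ν))) := by
  have h1 : Tendsto (fun x : ℝ => x ^ ν) (𝓝[>] 0) (𝓝 (0 ^ ν)) :=
    (Real.continuousAt_rpow_const 0 ν (Or.inr hν)).tendsto.mono_left nhdsWithin_le_nhds
  refine (h1.mul (tendsto_besselJ_div_rpow ν)).congr' ?_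
  filter_upwards [eventually_mem_nhdsWithin] with x hx
  have := (Real.rpow_pos_of_pos (Set.mem_Ioi.1 hx) ν).ne'
  field_simp

lemma tendsto_besselJ_zero_of_pos {ν : ℝ} (hν : 0 < ν) :
    Tendsto (besselJ ν) (𝓝[>] 0) (𝓝 0) := by
  simpa [Real.zero_rpow hν.ne'] using tendsto_besselJ_zero hν.le

lemma tendsto_mul_deriv_besselJ_zero {ν : ℝ} (hν : 0 ≤ ν) :
    Tendsto (fun x => x * deriv (besselJ ν) x) (𝓝[>] 0) (𝓝 0) := by
  have hid : Tendsto (fun x : ℝ => x) (𝓝[>] 0) (𝓝 0) := nhdsWithin_le_nhds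
  have h1 := (tendsto_besselJ_zero hν).const_mul ν
  have h2 := hid.mul (tendsto_besselJ_zero_of_pos (ν := ν + 1) (by linarith))
  have h3 := h1.sub h2
  rw [mul_zero, sub_zero, ← mul_assoc] at h3
  have h0 : ν * (0 : ℝ) ^ ν = 0 := by
    rcases hν.eq_or_lt with rfl | h
    · simp
    · rw [Real.zero_rpow h.ne', mul_zero]
  rw [h0, zero_mul] at h3
  refine h3.congr' ?_
  filter_upwards [eventually_mem_nhdsWithin] with x hx
  have hx : 0 < x := hx
  rw [isCylinderFamily_besselJ.deriv_eq_sub' ν hx]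
  field_simp

lemma eventually_wronskian_besselJ_pos {ν μ : ℝ} (hν : 0 ≤ ν) (h : ν < μ) :
    ∀ᶠ x in 𝓝[>] 0,
      0 < besselJ ν x * deriv (besselJ μ) x - deriv (besselJ ν) x * besselJ μ x := by
  have hμ : 0 < μ := hν.trans_lt h
  have h0 : Tendsto (fun x => x * (besselJ ν x * deriv (besselJ μ) x -
      deriv (besselJ ν) x * besselJ μ x)) (𝓝[>] 0) (𝓝 0) := by
    have h1 := ((tendsto_besselJ_zero hν).mul (tendsto_mul_deriv_besselJ_zero hμ.le)).sub
      ((tendsto_mul_deriv_besselJ_zero hν).mul (tendsto_besselJ_zero_of_pos hμ))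
    rw [mul_zero, mul_zero, sub_zero] at h1
    exact h1.congr fun x => by ring
  have h1 := eventually_pos_of_tendsto_zero h0 (by
    filter_upwards [eventually_mem_nhdsWithin] with x hx
    exact (isCylinderFamily_besselJ.isBesselSolution ν).hasDerivAt_mul_wronskian
      (isCylinderFamily_besselJ.isBesselSolution μ) hx) (by
    filter_upwards [eventually_mem_nhdsWithin, eventually_besselJ_pos hν,
      eventually_besselJ_pos hμ.le] with x (hx : 0 < x) h1 h2
    have : 0 < μ ^ 2 - ν ^ 2 := by nlinarith
    positivity)
  filter_upwards [h1, eventually_mem_nhdsWithin] with x hx hx0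
  exact (mul_pos_iff_of_pos_left hx0).1 hx

lemma tendsto_besselY_div_besselJ {μ : ℝ} (hμ : 0 ≤ μ) :
    Tendsto (fun x => besselY μ x / besselJ μ x) (𝓝[>] 0) atBot := by
  obtain ⟨ℓ, hℓ⟩ : ∃ ℓ, Tendsto (besselJ μ) (𝓝[>] 0) (𝓝 ℓ) := ⟨_, tendsto_besselJ_zero hμ⟩
  have hJ := (isCylinderFamily_besselJ.isBesselSolution μ).hasDerivAt
  have hY := (isCylinderFamily_besselY.isBesselSolution μ).hasDerivAt
  refine tendsto_atBot_of_div_le_deriv (c := 2 / π / (|ℓ| + 1) ^ 2) (by positivity) ?_ ?_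
    (f' := fun x => (deriv (besselY μ) x * besselJ μ x - besselY μ x * deriv (besselJ μ) x) /
      besselJ μ x ^ 2)
  · filter_upwards [eventually_mem_nhdsWithin, eventually_besselJ_pos hμ] with x hx hp
    exact (hY x hx).fun_div (hJ x hx) hp.ne'
  · filter_upwards [eventually_mem_nhdsWithin, eventually_besselJ_pos hμ,
      hℓ.eventually_lt_const (show ℓ < |ℓ| + 1 by linarith [le_abs_self ℓ])] with x hx hp hlt
    have hx : 0 < x := hx
    have hW := mul_wronskian_besselJ_besselY μ hx
    rw [show deriv (besselY μ) x * besselJ μ x - besselY μ x * deriv (besselJ μ) x = 2 / π / x by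
      rw [← hW]; field_simp, div_right_comm _ _ x]
    gcongr

lemma eventually_besselY_neg {μ : ℝ} (hμ : 0 ≤ μ) : ∀ᶠ x in 𝓝[>] 0, besselY μ x < 0 := by
  filter_upwards [(tendsto_besselY_div_besselJ hμ).eventually_lt_atBot 0,
    eventually_besselJ_pos hμ] with x h hp
  rwa [div_lt_iff₀ hp, zero_mul] at h

lemma not_eventually_le_besselY {μ : ℝ} (hμ : 0 < μ) (m : ℝ) :
    ¬ ∀ᶠ x in 𝓝[>] 0, m ≤ besselY μ x := by
  intro h
  have hY := (isCylinderFamily_besselY.isBesselSolution μ).hasDerivAt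
  have h0 : Tendsto (fun x => x * deriv (besselJ μ) x * besselY μ x) (𝓝[>] 0) (𝓝 0) := by
    have h1 := (tendsto_mul_deriv_besselJ_zero hμ.le).abs.mul_const |m|
    rw [abs_zero, zero_mul] at h1
    refine squeeze_zero_norm' ?_ h1
    filter_upwards [h, eventually_besselY_neg hμ.le] with x hx hx'
    rw [Real.norm_eq_abs, abs_mul]
    refine mul_le_mul_of_nonneg_left ?_ (abs_nonneg _)
    rw [abs_of_neg hx', abs_of_neg (hx.trans_lt hx')]
    linarith
  have hπ : 0 < 1 / π := by positivity
  have hbot : Tendsto (besselY μ) (𝓝[>] 0) atBot := by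
    refine tendsto_atBot_of_div_le_deriv one_pos
      (by filter_upwards [eventually_mem_nhdsWithin] with x hx using hY x hx) ?_
    filter_upwards [eventually_mem_nhdsWithin, eventually_besselJ_pos hμ.le,
      h0.eventually_const_lt (u := -(1 / π)) (by linarith),
      (tendsto_besselJ_zero_of_pos hμ).eventually_lt_const hπ] with x (hx : 0 < x) hJ h1 h2
    have hW := mul_wronskian_besselJ_besselY μ hx
    rw [div_le_iff₀ hx]
    by_contra! hlt
    have h3 : besselJ μ x * (deriv (besselY μ) x * x) < besselJ μ x * 1 := by gcongr
    have h4 : 2 / π = 1 / π + 1 / π := by ring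
    nlinarith
  obtain ⟨x, h1, h2⟩ := (h.and (hbot.eventually_lt_atBot m)).exists
  linarith

lemma frequently_wronskian_pos_of_gt {ν μ : ℝ} (hν : 0 ≤ ν) (h : ν < μ) :
    ∃ᶠ x in 𝓝[>] 0,
      0 < besselJ ν x * deriv (besselY μ) x - deriv (besselJ ν) x * besselY μ x := by
  intro hW
  have hJ := (isCylinderFamily_besselJ.isBesselSolution ν).hasDerivAt
  have hY := (isCylinderFamily_besselY.isBesselSolution μ).hasDerivAt
  obtain ⟨ℓ, hℓ⟩ : ∃ ℓ, Tendsto (besselJ ν) (𝓝[>] 0) (𝓝 ℓ) := ⟨_, tendsto_besselJ_zero hν⟩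
  obtain ⟨δ, hδ, hs⟩ := mem_nhdsGT_iff_exists_Ioc_subset.1 (hW.and (eventually_besselJ_pos hν))
  have hd : ∀ x ∈ Set.Ioc 0 δ, HasDerivAt (fun x => besselY μ x / besselJ ν x)
      ((deriv (besselY μ) x * besselJ ν x - besselY μ x * deriv (besselJ ν) x) /
        besselJ ν x ^ 2) x := fun x hx =>
    (hY x hx.1).fun_div (hJ x hx.1) (hs hx).2.ne'
  have hm : AntitoneOn (fun x => besselY μ x / besselJ ν x) (Set.Ioc 0 δ) := by
    refine antitoneOn_of_deriv_nonpos (convex_Ioc 0 δ)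
      (fun x hx => (hd x hx).continuousAt.continuousWithinAt)
      (fun x hx => (hd x (interior_subset hx)).differentiableAt.differentiableWithinAt)
      fun x hx => ?_
    rw [(hd x (interior_subset hx)).deriv]
    refine div_nonpos_of_nonpos_of_nonneg ?_ (sq_nonneg _)
    have := not_lt.1 (hs (interior_subset hx)).1
    linarith
  refine not_eventually_le_besselY (hν.trans_lt h)
    (-(|besselY μ δ / besselJ ν δ| * (|ℓ| + 1))) ?_
  filter_upwards [Ioc_mem_nhdsGT hδ,
    hℓ.eventually_lt_const (show ℓ < |ℓ| + 1 by linarith [le_abs_self ℓ])] with x hx hlt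
  have hp := (hs hx).2
  have h1 := hm hx ⟨hδ, le_rfl⟩ hx.2
  simp only at h1
  rw [le_div_iff₀ hp] at h1
  refine le_trans ?_ h1
  have h2 := neg_abs_le (besselY μ δ / besselJ ν δ)
  have h3 := abs_nonneg (besselY μ δ / besselJ ν δ)
  nlinarith

/-- The right-hand side of the Prüfer equation `θ' = prueferRHS ν x θ` of Bessel's equation. -/
noncomputable def prueferRHS (ν x θ : ℝ) : ℝ :=
  1 - Real.sin θ * Real.cos θ / x - ν ^ 2 / x ^ 2 * Real.cos θ ^ 2

/-- `θ` is a Prüfer angle for the solution `u` of Bessel's equation. -/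
structure IsPrueferAngle (ν : ℝ) (u θ : ℝ → ℝ) : Prop where
  hasDerivAt : ∀ x, 0 < x → HasDerivAt θ (prueferRHS ν x (θ x)) x
  exists_eq : ∀ x, 0 < x → ∃ r, 0 < r ∧ u x = r * Real.cos (θ x) ∧ deriv u x = -r * Real.sin (θ x)

lemma IsBesselSolution.neg {ν : ℝ} {u : ℝ → ℝ} (hu : IsBesselSolution ν u) :
    IsBesselSolution ν fun x => -u x where
  hasDerivAt x hx := by
    rw [deriv.fun_neg]
    exact (hu.hasDerivAt x hx).fun_neg
  hasDerivAt_deriv x hx := by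
    have : deriv (fun x => -u x) = fun x => -deriv u x := funext fun _ => deriv.fun_neg
    rw [this]
    exact (hu.hasDerivAt_deriv x hx).fun_neg.congr_deriv (by ring)

lemma IsBesselSolution.exists_isPrueferAngle {ν : ℝ} {u : ℝ → ℝ} (hu : IsBesselSolution ν u)
    (hne : ∀ x, 0 < x → u x ^ 2 + deriv u x ^ 2 ≠ 0) {a : ℝ} (ha : 0 < a) (hpos : 0 < u a) :
    ∃ θ, IsPrueferAngle ν u θ ∧ |θ a| < π / 2 := by
  set R : ℝ → ℝ := fun x => √(u x ^ 2 + deriv u x ^ 2) with hR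
  set u'' : ℝ → ℝ := fun x => -(deriv u x / x) - (1 - ν ^ 2 / x ^ 2) * u x with hu''
  set q : ℝ → ℝ := fun x => (deriv u x ^ 2 - u x * u'' x) / (u x ^ 2 + deriv u x ^ 2) with hq
  have hd : ∀ x, 0 < x → HasDerivAt (deriv u) (u'' x) x := hu.hasDerivAt_deriv
  have hsq : ∀ x, 0 < x → 0 < u x ^ 2 + deriv u x ^ 2 := fun x hx =>
    lt_of_le_of_ne (by positivity) (hne x hx).symm
  have hRpos : ∀ x, 0 < x → 0 < R x := fun x hx => Real.sqrt_pos.2 (hsq x hx)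
  have hR2 : ∀ x, R x ^ 2 = u x ^ 2 + deriv u x ^ 2 := fun x => Real.sq_sqrt (by positivity)
  have hRd : ∀ x, 0 < x → HasDerivAt R ((u x * deriv u x + deriv u x * u'' x) / R x) x := by
    intro x hx
    have h := (((hu.hasDerivAt x hx).pow 2).add ((hd x hx).pow 2)).sqrt
      (hne x hx)
    refine h.congr_deriv ?_
    have := (hRpos x hx).ne'
    simp only [Pi.add_apply, Pi.pow_apply]
    change _ / (2 * R x) = _
    field_simp
    push_cast
    ring
  have hqc : ContinuousOn q (Set.Ioi 0) := by
    have h1 : ContinuousOn u (Set.Ioi 0) := fun x hx =>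
      (hu.hasDerivAt x hx).continuousAt.continuousWithinAt
    have h2 : ContinuousOn (deriv u) (Set.Ioi 0) := fun x hx =>
      (hd x hx).continuousAt.continuousWithinAt
    have h3 : ContinuousOn u'' (Set.Ioi 0) := by
      refine (h2.div continuousOn_id fun x hx => (ne_of_gt hx)).neg.sub
        ((continuousOn_const.sub (continuousOn_const.div (continuousOn_id.pow 2)
          fun x hx => pow_ne_zero 2 (ne_of_gt hx))).mul h1)
    exact ((h2.pow 2).sub (h1.mul h3)).div ((h1.pow 2).add (h2.pow 2)) fun x hx => hne x hx
  set z : ℂ := ⟨u a, -deriv u a⟩ with hz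
  have hzR : ‖z‖ = R a := by
    rw [Complex.norm_def, Complex.normSq_mk, hR]
    congr 1
    ring
  set θ : ℝ → ℝ := fun x => Complex.arg z + ∫ t in a..x, q t with hθ
  have hθa : θ a = Complex.arg z := by simp [hθ]
  have hθd : ∀ x, 0 < x → HasDerivAt θ (q x) x := by
    intro x hx
    refine (intervalIntegral.integral_hasDerivAt_right ?_ ?_ ?_).const_add _
    · refine (hqc.mono fun t ht => ?_).intervalIntegrable
      exact (lt_min ha hx).trans_le ht.1
    · exact hqc.stronglyMeasurableAtFilter isOpen_Ioi x hx
    · exact hqc.continuousAt (Ioi_mem_nhds hx)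
  have hqR : ∀ x, 0 < x → q x * R x ^ 2 = deriv u x ^ 2 - u x * u'' x := by
    intro x hx
    rw [hR2, hq]
    exact div_mul_cancel₀ _ (hne x hx)
  have hconst : ∀ x, 0 < x →
      (u x * Real.cos (θ x) - deriv u x * Real.sin (θ x)) / R x = 1 ∧
      (u x * Real.sin (θ x) + deriv u x * Real.cos (θ x)) / R x = 0 := by
    have hd1 : ∀ x, 0 < x → HasDerivAt
        (fun x => (u x * Real.cos (θ x) - deriv u x * Real.sin (θ x)) / R x) 0 x := by
      intro x hx
      have h := (((hu.hasDerivAt x hx).fun_mul (hθd x hx).cos).fun_sub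
        ((hd x hx).fun_mul (hθd x hx).sin)).fun_div (hRd x hx) (hRpos x hx).ne'
      refine h.congr_deriv ?_
      have h1 := (hRpos x hx).ne'
      rw [div_eq_zero_iff]
      left
      field_simp
      linear_combination (deriv u x * Real.cos (θ x) - u'' x * Real.sin (θ x)) * hR2 x -
        (u x * Real.sin (θ x) + deriv u x * Real.cos (θ x)) * hqR x hx
    have hd2 : ∀ x, 0 < x → HasDerivAt
        (fun x => (u x * Real.sin (θ x) + deriv u x * Real.cos (θ x)) / R x) 0 x := by
      intro x hx
      have h := (((hu.hasDerivAt x hx).fun_mul (hθd x hx).sin).fun_add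
        ((hd x hx).fun_mul (hθd x hx).cos)).fun_div (hRd x hx) (hRpos x hx).ne'
      refine h.congr_deriv ?_
      have h1 := (hRpos x hx).ne'
      rw [div_eq_zero_iff]
      left
      field_simp
      linear_combination (deriv u x * Real.sin (θ x) + u'' x * Real.cos (θ x)) * hR2 x +
        (u x * Real.cos (θ x) - deriv u x * Real.sin (θ x)) * hqR x hx
    intro x hx
    have e1 := isOpen_Ioi.is_const_of_deriv_eq_zero isPreconnected_Ioi
      (fun y hy => (hd1 y hy).differentiableAt.differentiableWithinAt)
      (fun y hy => (hd1 y hy).deriv) hx ha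
    have e2 := isOpen_Ioi.is_const_of_deriv_eq_zero isPreconnected_Ioi
      (fun y hy => (hd2 y hy).differentiableAt.differentiableWithinAt)
      (fun y hy => (hd2 y hy).deriv) hx ha
    have hc : R a * Real.cos (θ a) = u a := by
      rw [hθa, ← hzR, Complex.norm_mul_cos_arg]
    have hs : R a * Real.sin (θ a) = -deriv u a := by
      rw [hθa, ← hzR, Complex.norm_mul_sin_arg]
    have hRa := (hRpos a ha).ne'
    have hsc := Real.sin_sq_add_cos_sq (θ a)
    refine ⟨e1.trans ?_, e2.trans ?_⟩
    · rw [← hc, ← neg_neg (deriv u a), ← hs, div_eq_one_iff_eq hRa]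
      linear_combination R a * hsc
    · rw [← hc, ← neg_neg (deriv u a), ← hs, div_eq_zero_iff]
      left
      ring
  have hpolar : ∀ x, 0 < x →
      u x = R x * Real.cos (θ x) ∧ deriv u x = -R x * Real.sin (θ x) := by
    intro x hx
    obtain ⟨h1, h2⟩ := hconst x hx
    rw [div_eq_one_iff_eq (hRpos x hx).ne'] at h1
    rw [div_eq_zero_iff, or_iff_left (hRpos x hx).ne'] at h2
    have hsc := Real.sin_sq_add_cos_sq (θ x)
    constructor
    · linear_combination Real.cos (θ x) * h1 + Real.sin (θ x) * h2 - u x * hsc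
    · linear_combination -Real.sin (θ x) * h1 + Real.cos (θ x) * h2 - deriv u x * hsc
  refine ⟨θ, ⟨fun x hx => (hθd x hx).congr_deriv ?_,
    fun x hx => ⟨R x, hRpos x hx, hpolar x hx⟩⟩, ?_⟩
  · obtain ⟨h1, h2⟩ := hpolar x hx
    have hR0 := (hRpos x hx).ne'
    have h := hqR x hx
    refine mul_right_cancel₀ (pow_ne_zero 2 hR0) (h.trans ?_)
    rw [hu'', prueferRHS]
    dsimp only
    rw [h2, h1]
    have hsc := Real.sin_sq_add_cos_sq (θ x)
    field_simp
    linear_combination x ^ 2 * hsc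
  · rw [hθa, Complex.abs_arg_lt_pi_div_two_iff]
    exact Or.inl hpos

lemma prueferRHS_eq (ν x θ : ℝ) : prueferRHS ν x θ =
    1 - Real.sin (2 * θ) / 2 / x - ν ^ 2 / x ^ 2 * ((1 + Real.cos (2 * θ)) / 2) := by
  rw [prueferRHS, Real.sin_two_mul, Real.cos_two_mul]
  ring

lemma prueferRHS_add_pi (ν x θ : ℝ) : prueferRHS ν x (θ + π) = prueferRHS ν x θ := by
  simp [prueferRHS]

lemma prueferRHS_le_of_sq_le {μ ν : ℝ} (h : μ ^ 2 ≤ ν ^ 2) (x θ : ℝ) :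
    prueferRHS ν x θ ≤ prueferRHS μ x θ := by
  unfold prueferRHS
  gcongr

lemma prueferRHS_sub_le (ν : ℝ) {x : ℝ} (hx : 0 < x) (θ χ : ℝ) :
    prueferRHS ν x θ - prueferRHS ν x χ ≤ (1 / x + ν ^ 2 / x ^ 2) * |θ - χ| := by
  have hs : -(Real.sin (2 * θ) - Real.sin (2 * χ)) ≤ 2 * |θ - χ| := by
    refine (neg_le_abs _).trans ((Real.abs_sin_sub_sin_le _ _).trans_eq ?_)
    rw [← mul_sub, abs_mul, abs_two]
  have hc : -(Real.cos (2 * θ) - Real.cos (2 * χ)) ≤ 2 * |θ - χ| := by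
    refine (neg_le_abs _).trans ((Real.abs_cos_sub_cos_le _ _).trans_eq ?_)
    rw [← mul_sub, abs_mul, abs_two]
  have h1 : 0 ≤ 1 / x := by positivity
  have h2 : 0 ≤ ν ^ 2 / x ^ 2 := by positivity
  rw [prueferRHS_eq, prueferRHS_eq]
  have e1 := mul_le_mul_of_nonneg_left hs h1
  have e2 := mul_le_mul_of_nonneg_left hc h2
  have e : 1 - Real.sin (2 * θ) / 2 / x - ν ^ 2 / x ^ 2 * ((1 + Real.cos (2 * θ)) / 2) -
      (1 - Real.sin (2 * χ) / 2 / x - ν ^ 2 / x ^ 2 * ((1 + Real.cos (2 * χ)) / 2)) =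
      (1 / x * -(Real.sin (2 * θ) - Real.sin (2 * χ)) +
        ν ^ 2 / x ^ 2 * -(Real.cos (2 * θ) - Real.cos (2 * χ))) / 2 := by ring
  rw [e]
  linarith

/-- Comparison principle for the Prüfer equation: a larger order gives a smaller angle. -/
lemma le_of_hasDerivAt_prueferRHS {μ ν a : ℝ} {f g : ℝ → ℝ} (h : μ ^ 2 ≤ ν ^ 2) (ha : 0 < a)
    (hf : ∀ x, 0 < x → HasDerivAt f (prueferRHS ν x (f x)) x)
    (hg : ∀ x, 0 < x → HasDerivAt g (prueferRHS μ x (g x)) x) (hfg : f a ≤ g a) {x : ℝ}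
    (hx : a ≤ x) : f x ≤ g x := by
  set K : ℝ := 1 / a + μ ^ 2 / a ^ 2 with hK
  have hbd : ∀ ε > 0, f x - g x ≤ ε * Real.exp ((K + 1) * (x - a)) := by
    intro ε hε
    have hd : ∀ y, a ≤ y → HasDerivAt (fun y => f y - g y)
        (prueferRHS ν y (f y) - prueferRHS μ y (g y)) y := fun y hy =>
      (hf y (ha.trans_le hy)).fun_sub (hg y (ha.trans_le hy))
    refine image_le_of_deriv_right_lt_deriv_boundary (f := fun y => f y - g y) (a := a) (b := x)
      (B := fun y => ε * Real.exp ((K + 1) * (y - a)))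
      (B' := fun y => (K + 1) * (ε * Real.exp ((K + 1) * (y - a))))
      (fun y hy => (hd y hy.1).continuousAt.continuousWithinAt)
      (fun y hy => (hd y hy.1).hasDerivWithinAt) ?_ (fun y => ?_) (fun y hy hB => ?_)
      ⟨hx, le_rfl⟩
    · simp only [sub_self, mul_zero, Real.exp_zero]
      linarith
    · have := (((hasDerivAt_id y).sub_const a).const_mul (K + 1)).exp.const_mul ε
      exact this.congr_deriv (by simp; ring)
    · rw [← hB]
      have hpos : 0 < f y - g y := by rw [hB]; positivity
      have hy0 : 0 < y := ha.trans_le hy.1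
      have h1 := prueferRHS_le_of_sq_le h y (f y)
      have h2 := prueferRHS_sub_le μ hy0 (f y) (g y)
      rw [abs_of_pos hpos] at h2
      have h3 : 1 / y + μ ^ 2 / y ^ 2 ≤ K := by
        rw [hK]
        have := hy.1
        gcongr
      have h4 := mul_le_mul_of_nonneg_right h3 hpos.le
      linarith
  by_contra! hlt
  have h1 := hbd ((f x - g x) / 2 / Real.exp ((K + 1) * (x - a)))
    (div_pos (by linarith) (Real.exp_pos _))
  rw [div_mul_cancel₀ _ (Real.exp_pos _).ne'] at h1
  linarith

namespace IsPrueferAngle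

variable {ν μ : ℝ} {u v θ χ : ℝ → ℝ}

lemma continuousOn (hθ : IsPrueferAngle ν u θ) {a : ℝ} (ha : 0 < a) :
    ContinuousOn θ (Set.Ici a) := fun x hx =>
  (hθ.hasDerivAt x (ha.trans_le hx)).continuousAt.continuousWithinAt

lemma wronskian_eq (hθ : IsPrueferAngle ν u θ) (hχ : IsPrueferAngle μ v χ) {x : ℝ} (hx : 0 < x) :
    ∃ r, 0 < r ∧ u x * deriv v x - deriv u x * v x = r * Real.sin (θ x - χ x) := by
  obtain ⟨r, hr, hu, hu'⟩ := hθ.exists_eq x hx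
  obtain ⟨s, hs, hv, hv'⟩ := hχ.exists_eq x hx
  refine ⟨r * s, mul_pos hr hs, ?_⟩
  rw [hu, hu', hv, hv', Real.sin_sub]
  ring

lemma lt_of_wronskian_pos (hθ : IsPrueferAngle ν u θ) (hχ : IsPrueferAngle μ v χ) {a : ℝ}
    (ha : 0 < a) (hθa : |θ a| < π / 2) (hχa : |χ a| < π / 2)
    (hW : 0 < u a * deriv v a - deriv u a * v a) : χ a < θ a := by
  obtain ⟨r, hr, h⟩ := hθ.wronskian_eq hχ ha
  rw [h] at hW
  by_contra! hle
  rw [abs_lt] at hθa hχa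
  have := Real.sin_nonpos_of_nonpos_of_neg_pi_le (x := θ a - χ a) (by linarith) (by linarith)
  exact hW.not_ge (mul_nonpos_of_nonneg_of_nonpos hr.le this)

lemma le_of_le (hθ : IsPrueferAngle ν u θ) (hχ : IsPrueferAngle μ v χ) (h : ν ^ 2 ≤ μ ^ 2) {a x : ℝ}
    (ha : 0 < a) (hle : χ a ≤ θ a) (hx : a ≤ x) : χ x ≤ θ x :=
  le_of_hasDerivAt_prueferRHS h ha hχ.hasDerivAt hθ.hasDerivAt hle hx

end IsPrueferAngle

lemma lt_of_forall_ne_of_lt {f : ℝ → ℝ} {a c : ℝ} (hf : ContinuousOn f (Set.Ici a))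
    (hne : ∀ x, a ≤ x → f x ≠ c) (ha : c < f a) {x : ℝ} (hx : a ≤ x) : c < f x := by
  by_contra! hle
  obtain ⟨y, hy, hyc⟩ := isPreconnected_Ici.intermediate_value hx (Set.self_mem_Ici) hf
    ⟨hle, ha.le⟩
  exact hne y hy hyc

lemma lt_of_forall_ne_of_gt {f : ℝ → ℝ} {a c : ℝ} (hf : ContinuousOn f (Set.Ici a))
    (hne : ∀ x, a ≤ x → f x ≠ c) (ha : f a < c) {x : ℝ} (hx : a ≤ x) : f x < c := by
  by_contra! hle
  obtain ⟨y, hy, hyc⟩ := isPreconnected_Ici.intermediate_value (Set.self_mem_Ici) hx hf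
    ⟨ha.le, hle⟩
  exact hne y hy hyc

lemma besselJ_sq_add_deriv_sq_ne_zero (ν : ℝ) {x : ℝ} (hx : 0 < x) :
    besselJ ν x ^ 2 + deriv (besselJ ν) x ^ 2 ≠ 0 := by
  intro h
  obtain ⟨h1, h2⟩ := (add_eq_zero_iff_of_nonneg (sq_nonneg _) (sq_nonneg _)).1 h
  have hW := mul_wronskian_besselJ_besselY ν hx
  rw [pow_eq_zero_iff two_ne_zero] at h1 h2
  rw [h1, h2] at hW
  have : 0 < 2 / π := by positivity
  simp only [zero_mul, sub_zero, mul_zero] at hW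
  linarith

lemma besselY_sq_add_deriv_sq_ne_zero (ν : ℝ) {x : ℝ} (hx : 0 < x) :
    besselY ν x ^ 2 + deriv (besselY ν) x ^ 2 ≠ 0 := by
  intro h
  obtain ⟨h1, h2⟩ := (add_eq_zero_iff_of_nonneg (sq_nonneg _) (sq_nonneg _)).1 h
  have hW := mul_wronskian_besselJ_besselY ν hx
  rw [pow_eq_zero_iff two_ne_zero] at h1 h2
  rw [h1, h2] at hW
  have : 0 < 2 / π := by positivity
  simp only [sub_zero, mul_zero] at hW
  linarith

lemma exists_isPrueferAngle_besselJ (ν : ℝ) {a : ℝ} (ha : 0 < a) (hpos : 0 < besselJ ν a) :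
    ∃ θ, IsPrueferAngle ν (besselJ ν) θ ∧ |θ a| < π / 2 :=
  (isCylinderFamily_besselJ.isBesselSolution ν).exists_isPrueferAngle
    (fun _ hx => besselJ_sq_add_deriv_sq_ne_zero ν hx) ha hpos

lemma exists_isPrueferAngle_neg_besselY (ν : ℝ) {a : ℝ} (ha : 0 < a) (hneg : besselY ν a < 0) :
    ∃ θ, IsPrueferAngle ν (fun x => -besselY ν x) θ ∧ |θ a| < π / 2 := by
  refine (isCylinderFamily_besselY.isBesselSolution ν).neg.exists_isPrueferAngle
    (fun x hx => ?_) ha (neg_pos.2 hneg)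
  rw [deriv.fun_neg, neg_sq, neg_sq]
  exact besselY_sq_add_deriv_sq_ne_zero ν hx

lemma wronskian_besselJ_besselY_eq {ν μ : ℝ} {θ ψ : ℝ → ℝ} (hθ : IsPrueferAngle ν (besselJ ν) θ)
    (hψ : IsPrueferAngle μ (fun x => -besselY μ x) ψ) {x : ℝ} (hx : 0 < x) :
    ∃ r, 0 < r ∧ besselJ ν x * deriv (besselY μ) x - deriv (besselJ ν) x * besselY μ x =
      r * Real.sin (ψ x - θ x) := by
  obtain ⟨r, hr, h⟩ := hθ.wronskian_eq hψ hx
  refine ⟨r, hr, ?_⟩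
  rw [deriv.fun_neg] at h
  rw [← neg_sub (θ x) (ψ x), Real.sin_neg]
  linarith

lemma besselY_angle_sub_mem_Ioo {μ a : ℝ} {χ ψ : ℝ → ℝ} (ha : 0 < a)
    (hχ : IsPrueferAngle μ (besselJ μ) χ) (hψ : IsPrueferAngle μ (fun x => -besselY μ x) ψ)
    (hχa : |χ a| < π / 2) (hψa : |ψ a| < π / 2) {x : ℝ} (hx : a ≤ x) :
    ψ x - χ x ∈ Set.Ioo 0 π := by
  have hs : ∀ y, a ≤ y → 0 < Real.sin (ψ y - χ y) := by
    intro y hy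
    have hy0 := ha.trans_le hy
    obtain ⟨r, hr, h⟩ := wronskian_besselJ_besselY_eq hχ hψ hy0
    have hW := mul_wronskian_besselJ_besselY μ hy0
    rw [h] at hW
    have : 0 < y * r * Real.sin (ψ y - χ y) := by
      rw [mul_assoc, hW]
      positivity
    exact (mul_pos_iff_of_pos_left (mul_pos hy0 hr)).1 this
  rw [abs_lt] at hχa hψa
  have hc := (hψ.continuousOn ha).sub (hχ.continuousOn ha)
  have hsa := hs a le_rfl
  have h0 : 0 < ψ a - χ a := by
    by_contra! hle
    exact hsa.not_ge (Real.sin_nonpos_of_nonpos_of_neg_pi_le hle (by linarith))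
  constructor
  · refine lt_of_forall_ne_of_lt hc (fun y hy h => ?_) h0 hx
    have := hs y hy
    simp only [Pi.sub_apply] at h
    simp [h] at this
  · refine lt_of_forall_ne_of_gt hc (fun y hy h => ?_)
      (show ψ a - χ a < π by linarith) hx
    have := hs y hy
    simp only [Pi.sub_apply] at h
    simp [h] at this

lemma wronskian_besselJ_succ_pos {μ x : ℝ} (hμ : 0 ≤ μ) (hx : 0 < x)
    (h : besselJ μ x * besselJ (μ + 1) x ≤ 0) :
    0 < besselJ μ x * deriv (besselJ (μ + 1)) x - deriv (besselJ μ) x * besselJ (μ + 1) x := by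
  have h1 := isCylinderFamily_besselJ.deriv_eq_sub (μ + 1) hx
  have h2 := isCylinderFamily_besselJ.deriv_eq_sub' μ hx
  rw [add_sub_cancel_right] at h1
  have hne : 0 < besselJ μ x ^ 2 + besselJ (μ + 1) x ^ 2 := by
    refine lt_of_le_of_ne (by positivity) fun h0 => ?_
    obtain ⟨e1, e2⟩ := (add_eq_zero_iff_of_nonneg (sq_nonneg _) (sq_nonneg _)).1 h0.symm
    rw [pow_eq_zero_iff two_ne_zero] at e1 e2
    refine besselJ_sq_add_deriv_sq_ne_zero μ hx ?_
    rw [h2, e1, e2]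
    ring
  have h3 : (2 * μ + 1) / x * (besselJ μ x * besselJ (μ + 1) x) ≤ 0 :=
    mul_nonpos_of_nonneg_of_nonpos (by positivity) h
  rw [h1, h2]
  have e : besselJ μ x * (besselJ μ x - (μ + 1) / x * besselJ (μ + 1) x) -
      (μ / x * besselJ μ x - besselJ (μ + 1) x) * besselJ (μ + 1) x =
      besselJ μ x ^ 2 + besselJ (μ + 1) x ^ 2 -
        (2 * μ + 1) / x * (besselJ μ x * besselJ (μ + 1) x) := by ring
  rw [e]
  linarith

lemma besselJ_angle_sub_succ_lt_pi {μ a : ℝ} {χ ω : ℝ → ℝ} (hμ : 0 ≤ μ) (ha : 0 < a)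
    (hχ : IsPrueferAngle μ (besselJ μ) χ) (hω : IsPrueferAngle (μ + 1) (besselJ (μ + 1)) ω)
    (hχa : |χ a| < π / 2) (hωa : |ω a| < π / 2) {x : ℝ} (hx : a ≤ x) : χ x - ω x < π := by
  rw [abs_lt] at hχa hωa
  refine lt_of_forall_ne_of_gt ((hχ.continuousOn ha).sub (hω.continuousOn ha)) (fun y hy h => ?_)
    (show χ a - ω a < π by linarith) hx
  simp only [Pi.sub_apply] at h
  have hy0 := ha.trans_le hy
  obtain ⟨r, -, hW⟩ := hχ.wronskian_eq hω hy0
  rw [h, Real.sin_pi, mul_zero] at hW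
  obtain ⟨r, hr, hu, -⟩ := hχ.exists_eq y hy0
  obtain ⟨s, hs, hv, -⟩ := hω.exists_eq y hy0
  refine (wronskian_besselJ_succ_pos hμ hy0 ?_).ne' hW
  rw [hu, hv, eq_add_of_sub_eq h, add_comm π, Real.cos_add_pi]
  have : 0 ≤ r * s * Real.cos (ω y) ^ 2 := by positivity
  linarith

lemma besselJ_angle_sub_lt_pi {μ ν a : ℝ} {χ θ : ℝ → ℝ} (hμ : 0 ≤ μ) (hν : 0 ≤ ν) (h : ν ≤ μ + 1)
    (ha : 0 < a) (hχ : IsPrueferAngle μ (besselJ μ) χ) (hθ : IsPrueferAngle ν (besselJ ν) θ)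
    (hχa : |χ a| < π / 2) (hθa : |θ a| < π / 2) (hJ : 0 < besselJ (μ + 1) a)
    (hV : ν < μ + 1 →
      0 < besselJ ν a * deriv (besselJ (μ + 1)) a - deriv (besselJ ν) a * besselJ (μ + 1) a)
    {x : ℝ} (hx : a ≤ x) : χ x - θ x < π := by
  rcases h.eq_or_lt with rfl | h
  · exact besselJ_angle_sub_succ_lt_pi hμ ha hχ hθ hχa hθa hx
  · obtain ⟨ω, hω, hωa⟩ := exists_isPrueferAngle_besselJ (μ + 1) ha hJ
    have h1 := besselJ_angle_sub_succ_lt_pi hμ ha hχ hω hχa hωa hx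
    have h2 := hθ.le_of_le hω (by gcongr) ha
      (hθ.lt_of_wronskian_pos hω ha hθa hωa (hV h)).le hx
    linarith

/-- After a zero, the mixed Wronskian with `μ < ν ≤ μ + 1` stays nonpositive. -/
lemma wronskian_nonpos_of_eq_zero_of_lt {ν μ : ℝ} (hμ : 0 ≤ μ) (h : μ < ν) (h1 : ν ≤ μ + 1)
    {x₀ x : ℝ} (hx₀ : 0 < x₀) (hx : x₀ ≤ x)
    (hW : besselJ ν x₀ * deriv (besselY μ) x₀ - deriv (besselJ ν) x₀ * besselY μ x₀ = 0) :
    besselJ ν x * deriv (besselY μ) x - deriv (besselJ ν) x * besselY μ x ≤ 0 := by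
  have hν : 0 ≤ ν := hμ.trans h.le
  have hV : ∀ᶠ a in 𝓝[>] (0 : ℝ), ν < μ + 1 →
      0 < besselJ ν a * deriv (besselJ (μ + 1)) a - deriv (besselJ ν) a * besselJ (μ + 1) a := by
    rcases h1.eq_or_lt with h1 | h1
    · exact Eventually.of_forall fun a ha => absurd h1 ha.ne
    · exact (eventually_wronskian_besselJ_pos hν h1).mono fun a ha _ => ha
  obtain ⟨a, hJν, hJμ, hJ1, hYμ, hVμ, hV1, ha, hax⟩ := ((eventually_besselJ_pos hν).and <|
    (eventually_besselJ_pos hμ).and <| (eventually_besselJ_pos (add_nonneg hμ zero_le_one)).and <|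
    (eventually_besselY_neg hμ).and <| (eventually_wronskian_besselJ_pos hμ h).and <| hV.and <|
    Ioo_mem_nhdsGT hx₀).exists
  obtain ⟨θ, hθ, hθa⟩ := exists_isPrueferAngle_besselJ ν ha hJν
  obtain ⟨χ, hχ, hχa⟩ := exists_isPrueferAngle_besselJ μ ha hJμ
  obtain ⟨ψ, hψ, hψa⟩ := exists_isPrueferAngle_neg_besselY μ ha hYμ
  have hθχ := (hχ.lt_of_wronskian_pos hθ ha hχa hθa hVμ).le
  have hD : ∀ y, a ≤ y → 0 < ψ y - θ y ∧ ψ y - θ y < 2 * π := by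
    intro y hy
    obtain ⟨hS0, hS1⟩ := besselY_angle_sub_mem_Ioo ha hχ hψ hχa hψa hy
    have hT0 := hχ.le_of_le hθ (by gcongr) ha hθχ hy
    have hT1 := besselJ_angle_sub_lt_pi hμ hν h1 ha hχ hθ hχa hθa hJ1 hV1 hy
    constructor <;> linarith
  have hax' := hax.le
  obtain ⟨r, hr, hr'⟩ := wronskian_besselJ_besselY_eq hθ hψ hx₀
  rw [hW, zero_eq_mul, or_iff_right hr.ne'] at hr'
  have hD₀ : ψ x₀ - θ x₀ - π = 0 := by
    obtain ⟨h1, h2⟩ := hD x₀ hax'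
    rw [← Real.sin_eq_zero_iff_of_lt_of_lt (by linarith) (by linarith), Real.sin_sub_pi, hr',
      neg_zero]
  have hle : θ x + π ≤ ψ x :=
    le_of_hasDerivAt_prueferRHS (f := fun y => θ y + π) (by gcongr) hx₀
      (fun y hy => ((hθ.hasDerivAt y hy).add_const π).congr_deriv (prueferRHS_add_pi ..).symm)
      hψ.hasDerivAt (by linarith) hx
  obtain ⟨s, hs, hs'⟩ := wronskian_besselJ_besselY_eq hθ hψ (hx₀.trans_le hx)
  rw [hs']
  refine mul_nonpos_of_nonneg_of_nonpos hs.le ?_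
  have := Real.sin_nonneg_of_nonneg_of_le_pi (x := ψ x - θ x - π) (by linarith)
    (by linarith [(hD x (hax'.trans hx)).2])
  rw [Real.sin_sub_pi] at this
  linarith

/-- After a zero, the mixed Wronskian with `ν < μ ≤ ν + 1` stays nonpositive. -/
lemma wronskian_nonpos_of_eq_zero_of_gt {ν μ : ℝ} (hν : 0 ≤ ν) (h : ν < μ) (h1 : μ ≤ ν + 1)
    {x₀ x : ℝ} (hx₀ : 0 < x₀) (hx : x₀ ≤ x)
    (hW : besselJ ν x₀ * deriv (besselY μ) x₀ - deriv (besselJ ν) x₀ * besselY μ x₀ = 0) :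
    besselJ ν x * deriv (besselY μ) x - deriv (besselJ ν) x * besselY μ x ≤ 0 := by
  have hμ : 0 ≤ μ := hν.trans h.le
  have hV : ∀ᶠ a in 𝓝[>] (0 : ℝ), μ < ν + 1 →
      0 < besselJ μ a * deriv (besselJ (ν + 1)) a - deriv (besselJ μ) a * besselJ (ν + 1) a := by
    rcases h1.eq_or_lt with h1 | h1
    · exact Eventually.of_forall fun a ha => absurd h1 ha.ne
    · exact (eventually_wronskian_besselJ_pos hμ h1).mono fun a ha _ => ha
  obtain ⟨a, hJν, hJμ, hJ1, hYμ, hVν, hV1, ha, hax⟩ := ((eventually_besselJ_pos hν).and <|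
    (eventually_besselJ_pos hμ).and <| (eventually_besselJ_pos (add_nonneg hν zero_le_one)).and <|
    (eventually_besselY_neg hμ).and <| (eventually_wronskian_besselJ_pos hν h).and <| hV.and <|
    Ioo_mem_nhdsGT hx₀).exists
  obtain ⟨θ, hθ, hθa⟩ := exists_isPrueferAngle_besselJ ν ha hJν
  obtain ⟨χ, hχ, hχa⟩ := exists_isPrueferAngle_besselJ μ ha hJμ
  obtain ⟨ψ, hψ, hψa⟩ := exists_isPrueferAngle_neg_besselY μ ha hYμ
  have hχθ := (hθ.lt_of_wronskian_pos hχ ha hθa hχa hVν).le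
  have hD : ∀ y, a ≤ y → -π < ψ y - θ y ∧ ψ y - θ y < π := by
    intro y hy
    obtain ⟨hS0, hS1⟩ := besselY_angle_sub_mem_Ioo ha hχ hψ hχa hψa hy
    have hT0 := hθ.le_of_le hχ (by gcongr) ha hχθ hy
    have hT1 := besselJ_angle_sub_lt_pi hν hμ h1 ha hθ hχ hθa hχa hJ1 hV1 hy
    constructor <;> linarith
  have hax' := hax.le
  obtain ⟨r, hr, hr'⟩ := wronskian_besselJ_besselY_eq hθ hψ hx₀
  rw [hW, zero_eq_mul, or_iff_right hr.ne',
    Real.sin_eq_zero_iff_of_lt_of_lt (hD x₀ hax').1 (hD x₀ hax').2] at hr'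
  have hle : ψ x ≤ θ x := hθ.le_of_le hψ (by gcongr) hx₀ (by linarith) hx
  obtain ⟨s, hs, hs'⟩ := wronskian_besselJ_besselY_eq hθ hψ (hx₀.trans_le hx)
  rw [hs']
  exact mul_nonpos_of_nonneg_of_nonpos hs.le (Real.sin_nonpos_of_nonpos_of_neg_pi_le
    (by linarith) (hD x (hax'.trans hx)).1.le)

lemma wronskian_nonpos_of_eq_zero {ν μ : ℝ} (hν : 0 ≤ ν) (hμ : 0 ≤ μ) (hne : ν ≠ μ)
    (h : |ν - μ| ≤ 1) {x₀ x : ℝ} (hx₀ : 0 < x₀) (hx : x₀ ≤ x)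
    (hW : besselJ ν x₀ * deriv (besselY μ) x₀ - deriv (besselJ ν) x₀ * besselY μ x₀ = 0) :
    besselJ ν x * deriv (besselY μ) x - deriv (besselJ ν) x * besselY μ x ≤ 0 := by
  rw [abs_le] at h
  rcases hne.lt_or_gt with hlt | hlt
  · exact wronskian_nonpos_of_eq_zero_of_gt hν hlt (by linarith) hx₀ hx hW
  · exact wronskian_nonpos_of_eq_zero_of_lt hμ hlt (by linarith) hx₀ hx hW

lemma continuousOn_wronskian_besselJ_besselY (ν μ : ℝ) : ContinuousOn
    (fun x => besselJ ν x * deriv (besselY μ) x - deriv (besselJ ν) x * besselY μ x)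
    (Set.Ioi 0) := by
  intro x hx
  have hJ := isCylinderFamily_besselJ.isBesselSolution ν
  have hY := isCylinderFamily_besselY.isBesselSolution μ
  exact (((hJ.hasDerivAt x hx).continuousAt.mul (hY.hasDerivAt_deriv x hx).continuousAt).sub
    ((hJ.hasDerivAt_deriv x hx).continuousAt.mul
      (hY.hasDerivAt x hx).continuousAt)).continuousWithinAt

lemma eventually_wronskian_pos {ν μ : ℝ} (h : |ν - μ| < 1) : ∀ᶠ x in atTop,
    0 < besselJ ν x * deriv (besselY μ) x - deriv (besselJ ν) x * besselY μ x := by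
  rw [abs_lt] at h
  have hc : 0 < 2 / π * Real.cos ((μ - ν) * (π / 2)) := by
    refine mul_pos (by positivity) (Real.cos_pos_of_mem_Ioo ⟨?_, ?_⟩) <;> nlinarith [Real.pi_pos]
  filter_upwards [(tendsto_mul_wronskian_besselJ_besselY ν μ).eventually (lt_mem_nhds hc),
    eventually_gt_atTop 0] with x hx hx0
  exact (mul_pos_iff_of_pos_left hx0).1 hx

lemma wronskian_pos_of_abs_sub_lt_one {ν μ : ℝ} (hν : 0 ≤ ν) (hμ : 0 ≤ μ)
    (h : |ν - μ| < 1) {x : ℝ} (hx : 0 < x) :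
    0 < besselJ ν x * deriv (besselY μ) x - deriv (besselJ ν) x * besselY μ x := by
  rcases eq_or_ne ν μ with rfl | hne
  · refine (mul_pos_iff_of_pos_left hx).1 ?_
    rw [mul_wronskian_besselJ_besselY ν hx]
    positivity
  have hev := eventually_wronskian_pos h
  have hzero : ∀ y, 0 < y →
      besselJ ν y * deriv (besselY μ) y - deriv (besselJ ν) y * besselY μ y ≠ 0 := by
    intro y hy h0
    obtain ⟨z, hz, hyz⟩ := (hev.and (eventually_ge_atTop y)).exists
    exact hz.not_ge (wronskian_nonpos_of_eq_zero hν hμ hne h.le hy hyz h0)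
  by_contra! hle
  obtain ⟨z, hz, hxz⟩ := (hev.and (eventually_ge_atTop x)).exists
  obtain ⟨y, hy, hy0⟩ := isPreconnected_Ioi.intermediate_value hx (hx.trans_le hxz)
    (continuousOn_wronskian_besselJ_besselY ν μ) ⟨hle, hz.le⟩
  exact hzero y hy hy0

lemma wronskian_nonneg_of_abs_sub_le_one {ν μ : ℝ} (hν : 0 ≤ ν) (hμ : 0 ≤ μ)
    (h : |ν - μ| ≤ 1) {x : ℝ} (hx : 0 < x) :
    0 ≤ besselJ ν x * deriv (besselY μ) x - deriv (besselJ ν) x * besselY μ x := by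
  have hc : Continuous fun t : ℝ => besselJ (ν + t * (μ - ν)) x * deriv (besselY μ) x -
      deriv (besselJ (ν + t * (μ - ν))) x * besselY μ x := by
    have h0 : Continuous fun t : ℝ => ν + t * (μ - ν) := by fun_prop
    exact (((continuous_besselJ_left hx).comp h0).mul continuous_const).sub
      (((isCylinderFamily_besselJ.continuous_deriv_left hx
        (continuous_besselJ_left hx)).comp h0).mul continuous_const)
  have ht := (hc.tendsto 0).mono_left (nhdsWithin_le_nhds (s := Set.Ioi 0))
  simp only [zero_mul, add_zero] at ht
  refine ge_of_tendsto ht ?_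
  filter_upwards [Ioo_mem_nhdsGT (zero_lt_one (α := ℝ))] with t ⟨ht0, ht1⟩
  refine (wronskian_pos_of_abs_sub_lt_one ?_ hμ ?_ hx).le
  · nlinarith
  · have e : ν + t * (μ - ν) - μ = (1 - t) * (ν - μ) := by ring
    rw [e, abs_mul, abs_of_pos (by linarith)]
    nlinarith [abs_nonneg (ν - μ)]

lemma wronskian_ne_zero_of_abs_sub_le_one {ν μ : ℝ} (hν : 0 ≤ ν) (hμ : 0 ≤ μ) (hne : ν ≠ μ)
    (h : |ν - μ| ≤ 1) {x : ℝ} (hx : 0 < x) :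
    besselJ ν x * deriv (besselY μ) x - deriv (besselJ ν) x * besselY μ x ≠ 0 := by
  intro h0
  have hJ := isCylinderFamily_besselJ.isBesselSolution ν
  have hY := isCylinderFamily_besselY.isBesselSolution μ
  have hW : ∀ y, x < y →
      besselJ ν y * deriv (besselY μ) y - deriv (besselJ ν) y * besselY μ y = 0 := fun y hy =>
    (wronskian_nonpos_of_eq_zero hν hμ hne h hx hy.le h0).antisymm
      (wronskian_nonneg_of_abs_sub_le_one hν hμ h (hx.trans hy))
  have hJY : ∀ y, x < y → besselJ ν y * besselY μ y = 0 := by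
    intro y hy
    have hy0 := hx.trans hy
    have hd := hJ.hasDerivAt_mul_wronskian hY hy0
    have hd' := hd.unique ((hasDerivAt_const y (0 : ℝ)).congr_of_eventuallyEq <|
      (eventually_gt_nhds hy).mono fun z hz => by simp [hW z hz])
    rw [mul_eq_zero, div_eq_zero_iff, or_iff_left hy0.ne'] at hd'
    refine hd'.resolve_left fun hsq => hne ?_
    nlinarith [(sq_eq_sq₀ hμ hν).1 (sub_eq_zero.1 hsq)]
  have hJ0 : ∀ y, x < y → besselJ ν y = 0 := by
    intro y hy
    by_contra hJy
    have hy0 := hx.trans hy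
    have hd := ((hJ.hasDerivAt y hy0).fun_mul (hY.hasDerivAt y hy0)).unique
      ((hasDerivAt_const y (0 : ℝ)).congr_of_eventuallyEq <|
      (eventually_gt_nhds hy).mono fun z hz => by simp [hJY z hz])
    have hYy := (mul_eq_zero.1 (hJY y hy)).resolve_left hJy
    rw [hYy, mul_zero, zero_add, mul_eq_zero, or_iff_right hJy] at hd
    exact besselY_sq_add_deriv_sq_ne_zero μ hy0 (by rw [hYy, hd]; ring)
  have hy : x < x + 1 := by linarith
  have hd : deriv (besselJ ν) (x + 1) = 0 :=
    ((hasDerivAt_const (x + 1) (0 : ℝ)).congr_of_eventuallyEq <|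
      (eventually_gt_nhds hy).mono fun z hz => by simp [hJ0 z hz]).deriv
  exact besselJ_sq_add_deriv_sq_ne_zero ν (hx.trans hy) (by rw [hd, hJ0 _ hy]; ring)

lemma eventually_wronskian_neg {ν μ : ℝ} (h1 : 1 < |ν - μ|) (h2 : |ν - μ| < 2) :
    ∀ᶠ x in atTop,
      besselJ ν x * deriv (besselY μ) x - deriv (besselJ ν) x * besselY μ x < 0 := by
  have hπ := Real.pi_pos
  have hcos : Real.cos ((μ - ν) * (π / 2)) < 0 := by
    rw [← Real.cos_abs, abs_mul, abs_of_pos (by positivity : 0 < π / 2), abs_sub_comm]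
    refine Real.cos_neg_of_pi_div_two_lt_of_lt ?_ ?_ <;> nlinarith
  have hc : 2 / π * Real.cos ((μ - ν) * (π / 2)) < 0 :=
    mul_neg_of_pos_of_neg (by positivity) hcos
  filter_upwards [(tendsto_mul_wronskian_besselJ_besselY ν μ).eventually (gt_mem_nhds hc),
    eventually_gt_atTop 0] with x hx hx0
  by_contra! hle
  exact hx.not_ge (mul_nonneg hx0.le hle)

lemma exists_wronskian_eq_zero_of_lt {ν μ : ℝ} (hμ : 0 ≤ μ) (h : μ + 1 < ν) :
    ∃ x, 0 < x ∧
      besselJ ν x * deriv (besselY μ) x - deriv (besselJ ν) x * besselY μ x = 0 := by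
  have hν : 0 ≤ ν := by linarith
  obtain ⟨κ, hμκ, hκ⟩ := exists_between (lt_min h (by linarith : μ + 1 < μ + 2))
  obtain ⟨hκν, hκμ⟩ := lt_min_iff.1 hκ
  have hκ0 : 0 ≤ κ := by linarith
  obtain ⟨a, hJν, hJμ, hJκ, hYμ, hVμ, hVκ, ha : 0 < a⟩ :=
    ((eventually_besselJ_pos hν).and <| (eventually_besselJ_pos hμ).and <|
    (eventually_besselJ_pos hκ0).and <| (eventually_besselY_neg hμ).and <|
    (eventually_wronskian_besselJ_pos hμ (by linarith : μ < κ)).and <|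
    (eventually_wronskian_besselJ_pos hκ0 hκν).and self_mem_nhdsWithin).exists
  obtain ⟨θ, hθ, hθa⟩ := exists_isPrueferAngle_besselJ ν ha hJν
  obtain ⟨χ, hχ, hχa⟩ := exists_isPrueferAngle_besselJ μ ha hJμ
  obtain ⟨ω, hω, hωa⟩ := exists_isPrueferAngle_besselJ κ ha hJκ
  obtain ⟨ψ, hψ, hψa⟩ := exists_isPrueferAngle_neg_besselY μ ha hYμ
  obtain ⟨x, hWx, hax⟩ := ((eventually_wronskian_neg (ν := κ) (μ := μ)
    (by rw [abs_of_pos] <;> linarith) (by rw [abs_of_pos] <;> linarith)).and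
    (eventually_ge_atTop a)).exists
  have hωχ := hχ.le_of_le hω (by gcongr; linarith) ha
    (hχ.lt_of_wronskian_pos hω ha hχa hωa hVμ).le hax
  have hθω := hω.le_of_le hθ (by gcongr) ha (hω.lt_of_wronskian_pos hθ ha hωa hθa hVκ).le hax
  obtain ⟨hS0, hS1⟩ := besselY_angle_sub_mem_Ioo ha hχ hψ hχa hψa hax
  have hx : π < ψ x - ω x := by
    by_contra! hle
    obtain ⟨r, hr, hr'⟩ := wronskian_besselJ_besselY_eq hω hψ (ha.trans_le hax)
    rw [hr'] at hWx
    exact hWx.not_ge (mul_nonneg hr.le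
      (Real.sin_nonneg_of_nonneg_of_le_pi (by linarith) hle))
  rw [abs_lt] at hθa hψa
  obtain ⟨y, hy, hyπ⟩ := isPreconnected_Ici.intermediate_value Set.self_mem_Ici hax
    ((hψ.continuousOn ha).sub (hθ.continuousOn ha))
    (⟨by simp only [Pi.sub_apply]; linarith, by simp only [Pi.sub_apply]; linarith⟩ :
      π ∈ Set.Icc _ _)
  have hy0 := ha.trans_le hy
  obtain ⟨r, -, hr⟩ := wronskian_besselJ_besselY_eq hθ hψ hy0
  simp only [Pi.sub_apply] at hyπ
  exact ⟨y, hy0, by rw [hr, hyπ, Real.sin_pi, mul_zero]⟩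

lemma exists_wronskian_eq_zero_of_gt {ν μ : ℝ} (hν : 0 ≤ ν) (h : ν + 1 < μ) :
    ∃ x, 0 < x ∧
      besselJ ν x * deriv (besselY μ) x - deriv (besselJ ν) x * besselY μ x = 0 := by
  have hμ : 0 ≤ μ := by linarith
  obtain ⟨κ, hκ, hκμ⟩ := exists_between (max_lt (by linarith) (by linarith) :
    max ν (μ - 2) < μ - 1)
  obtain ⟨hνκ, hμκ⟩ := max_lt_iff.1 hκ
  have hκ0 : 0 ≤ κ := by linarith
  obtain ⟨a, hWa, hJν, hJμ, hJκ, hYμ, hVκ, hVν, ha : 0 < a⟩ :=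
    ((frequently_wronskian_pos_of_gt hν (by linarith : ν < μ)).and_eventually <|
    (eventually_besselJ_pos hν).and <| (eventually_besselJ_pos hμ).and <|
    (eventually_besselJ_pos hκ0).and <| (eventually_besselY_neg hμ).and <|
    (eventually_wronskian_besselJ_pos hκ0 (by linarith : κ < μ)).and <|
    (eventually_wronskian_besselJ_pos hν hνκ).and self_mem_nhdsWithin).exists
  obtain ⟨θ, hθ, hθa⟩ := exists_isPrueferAngle_besselJ ν ha hJν
  obtain ⟨χ, hχ, hχa⟩ := exists_isPrueferAngle_besselJ μ ha hJμ
  obtain ⟨ω, hω, hωa⟩ := exists_isPrueferAngle_besselJ κ ha hJκ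
  obtain ⟨ψ, hψ, hψa⟩ := exists_isPrueferAngle_neg_besselY μ ha hYμ
  obtain ⟨x, hWx, hax⟩ := ((eventually_wronskian_neg (ν := κ) (μ := μ)
    (by rw [abs_of_neg] <;> linarith) (by rw [abs_of_neg] <;> linarith)).and
    (eventually_ge_atTop a)).exists
  have hχω := hω.le_of_le hχ (by gcongr; linarith) ha
    (hω.lt_of_wronskian_pos hχ ha hωa hχa hVκ).le hax
  have hωθ := hθ.le_of_le hω (by gcongr) ha (hθ.lt_of_wronskian_pos hω ha hθa hωa hVν).le hax
  obtain ⟨hS0, hS1⟩ := besselY_angle_sub_mem_Ioo ha hχ hψ hχa hψa hax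
  have hx : ψ x - ω x < 0 := by
    by_contra! hle
    obtain ⟨r, hr, hr'⟩ := wronskian_besselJ_besselY_eq hω hψ (ha.trans_le hax)
    rw [hr'] at hWx
    exact hWx.not_ge (mul_nonneg hr.le
      (Real.sin_nonneg_of_nonneg_of_le_pi hle (by linarith)))
  have ha0 : 0 < ψ a - θ a := by
    by_contra! hle
    rw [abs_lt] at hθa hψa
    obtain ⟨r, hr, hr'⟩ := wronskian_besselJ_besselY_eq hθ hψ ha
    rw [hr'] at hWa
    exact hWa.not_ge (mul_nonpos_of_nonneg_of_nonpos hr.le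
      (Real.sin_nonpos_of_nonpos_of_neg_pi_le hle (by linarith)))
  obtain ⟨y, hy, hy'⟩ := isPreconnected_Ici.intermediate_value hax Set.self_mem_Ici
    ((hψ.continuousOn ha).sub (hθ.continuousOn ha))
    (⟨by simp only [Pi.sub_apply]; linarith, ha0.le⟩ : (0 : ℝ) ∈ Set.Icc _ _)
  have hy0 := ha.trans_le hy
  obtain ⟨r, -, hr⟩ := wronskian_besselJ_besselY_eq hθ hψ hy0
  simp only [Pi.sub_apply] at hy'
  exact ⟨y, hy0, by rw [hr, hy', Real.sin_zero, mul_zero]⟩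

/-- Nonvanishing of the mixed Wronskian
`W_{νμ}(x) = J_ν(x)·Y'_μ(x) − J'_ν(x)·Y_μ(x)`: for `ν, μ ≥ 0`, `ν ≠ μ`, it is
nonzero on all of `(0, ∞)` if and only if `0 < |ν − μ| ≤ 1`. -/
theorem mixed_wronskian_ne_zero_iff (ν μ : ℝ) (hν : 0 ≤ ν) (hμ : 0 ≤ μ)
    (hne : ν ≠ μ) :
    (∀ x : ℝ, 0 < x →
        besselJ ν x * deriv (besselY μ) x - deriv (besselJ ν) x * besselY μ x ≠ 0)
      ↔ (0 < |ν - μ| ∧ |ν - μ| ≤ 1) := by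
  refine ⟨fun hW => ⟨abs_pos.2 (sub_ne_zero.2 hne), ?_⟩, fun h x hx =>
    wronskian_ne_zero_of_abs_sub_le_one hν hμ hne h.2 hx⟩
  by_contra! h
  rcases lt_abs.1 h with h | h
  · obtain ⟨x, hx, h0⟩ := exists_wronskian_eq_zero_of_lt hμ (by linarith : μ + 1 < ν)
    exact hW x hx h0
  · obtain ⟨x, hx, h0⟩ := exists_wronskian_eq_zero_of_gt hν (by linarith : ν + 1 < μ)
    exact hW x hx h0
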